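/- Assume the ellipticity conditions η₂ < η₁ < η₃ and η₂ + η₃ > 2η₁, and let ē ∈ ℰ. Then there exist ε₀ > 0 and constants C₂, C > 0 such that for every ε ∈ (0, ε₀) there exist a map u in the admissible class with mean strain ē, a measurable ℤ³-periodic χ: ℝ³ → K₃, and total-variation bounds S₁, S₂, S₃ for the indicator functions χ₁, χ₂, χ₃ respectively, such that ∫_{[0,1]³} |e(u) − χ|² dx + ε(S₁ + S₂ + S₃) ≤ C₂ exp(−C |log ε|^{1/2}). -/

import Mathlib

open Matrix MeasureTheory

noncomputable section

/-- Three-dimensional Euclidean space. -/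
abbrev V3 : Type := EuclideanSpace ℝ (Fin 3)

/-- Build a Euclidean vector from its coordinates. -/
def vec3 (f : Fin 3 → ℝ) : V3 := (WithLp.equiv 2 (Fin 3 → ℝ)).symm f

/-- The three wells `e⁽¹⁾ = diag(η₃, η₁, η₂)`, `e⁽²⁾ = diag(η₂, η₃, η₁)`,
`e⁽³⁾ = diag(η₁, η₂, η₃)` (0-indexed). -/
def well3 (η₁ η₂ η₃ : ℝ) : Fin 3 → Matrix (Fin 3) (Fin 3) ℝ :=
  ![Matrix.diagonal ![η₃, η₁, η₂], Matrix.diagonal ![η₂, η₃, η₁], Matrix.diagonal ![η₁, η₂, η₃]]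

/-- The set `K₃ = {e⁽¹⁾, e⁽²⁾, e⁽³⁾}`. -/
def K3 (η₁ η₂ η₃ : ℝ) : Set (Matrix (Fin 3) (Fin 3) ℝ) :=
  {well3 η₁ η₂ η₃ 0, well3 η₁ η₂ η₃ 1, well3 η₁ η₂ η₃ 2}

/-- The auxiliary matrices `J₁ = diag(κ, η₁, η₁)`, `J₂ = diag(η₁, κ, η₁)`,
`J₃ = diag(η₁, η₁, κ)` with `κ = η₂ + η₃ - η₁` (0-indexed). -/
def Jmat3 (η₁ η₂ η₃ : ℝ) : Fin 3 → Matrix (Fin 3) (Fin 3) ℝ :=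
  ![Matrix.diagonal ![η₂ + η₃ - η₁, η₁, η₁],
    Matrix.diagonal ![η₁, η₂ + η₃ - η₁, η₁],
    Matrix.diagonal ![η₁, η₁, η₂ + η₃ - η₁]]

/-- The set `ℰ = conv{J₁,J₂,J₃} ∪ ⋃ⱼ [Jⱼ, e⁽ʲ⁾]`. -/
def Eset3 (η₁ η₂ η₃ : ℝ) : Set (Matrix (Fin 3) (Fin 3) ℝ) :=
  convexHull ℝ {Jmat3 η₁ η₂ η₃ 0, Jmat3 η₁ η₂ η₃ 1, Jmat3 η₁ η₂ η₃ 2} ∪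
    ⋃ j : Fin 3, segment ℝ (Jmat3 η₁ η₂ η₃ j) (well3 η₁ η₂ η₃ j)

/-- The symmetrized gradient `e(u)(x) = (1/2)(∇u(x) + ∇u(x)ᵀ)`, expressed via `fderiv`
(which, by Rademacher's theorem, exists a.e. for Lipschitz `u`). -/
def symGrad3 (u : V3 → V3) (x : V3) : Matrix (Fin 3) (Fin 3) ℝ := fun i j =>
  (fderiv ℝ u x (EuclideanSpace.single j 1) i + fderiv ℝ u x (EuclideanSpace.single i 1) j) / 2

/-- The unit cube `[0,1]³`. -/
def cube3 : Set V3 := {x | ∀ i, 0 ≤ x i ∧ x i ≤ 1}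

/-- The point of `ℝ³` corresponding to a lattice point `n ∈ ℤ³`. -/
def zlat (n : Fin 3 → ℤ) : V3 := vec3 fun i => (n i : ℝ)

/-- `ℤ³`-periodicity. -/
def ZPer {α : Type*} (f : V3 → α) : Prop := ∀ (x : V3) (n : Fin 3 → ℤ), f (x + zlat n) = f x

/-- `S` is a total-variation bound for the periodic function `f`: the dual (BV) formulation
of the BV seminorm on the torus. -/
def IsTVBound (f : V3 → ℝ) (S : ℝ) : Prop :=
  ∀ φ : V3 → V3, ContDiff ℝ (⊤ : ℕ∞) φ → ZPer φ → (∀ x, ‖φ x‖ ≤ 1) →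
    (∫ x in cube3, f x * ∑ i, fderiv ℝ φ x (EuclideanSpace.single i 1) i) ≤ S

/-- The indicator function of the phase `j`, i.e. of `{x : χ x = e⁽ʲ⁾}`. -/
def indic3 (η₁ η₂ η₃ : ℝ) (χ : V3 → Matrix (Fin 3) (Fin 3) ℝ) (j : Fin 3) : V3 → ℝ :=
  Set.indicator {x | χ x = well3 η₁ η₂ η₃ j} fun _ => (1 : ℝ)

/-- `u` belongs to the admissible class with mean strain `ē`:
`u(x) = (ē + s)x + v(x)` with `s` skew-symmetric and `v` Lipschitz and `ℤ³`-periodic. -/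
def Admissible (ebar : Matrix (Fin 3) (Fin 3) ℝ) (u : V3 → V3) : Prop :=
  ∃ s : Matrix (Fin 3) (Fin 3) ℝ, sᵀ = -s ∧
    ∃ (v : V3 → V3) (K : NNReal), LipschitzWith K v ∧ ZPer v ∧
      u = fun x => vec3 ((ebar + s).mulVec fun i => x i) + v x

/-- The covering map from `ℝ³` to the torus. -/
def torusMk (x : V3) : UnitAddTorus (Fin 3) := fun i => (x i : UnitAddCircle)

/-- The measurable section of `torusMk` with values in `[0,1)³`. -/
def torusLift (y : UnitAddTorus (Fin 3)) : V3 :=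
  WithLp.toLp 2 fun i => (AddCircle.measurableEquivIco 1 0 (y i) : ℝ)

lemma measurable_torusLift : Measurable torusLift := by
  refine (WithLp.measurable_toLp 2 (Fin 3 → ℝ)).comp (measurable_pi_lambda _ fun i => ?_)
  exact measurable_subtype_coe.comp
    ((AddCircle.measurableEquivIco 1 0).measurable.comp (measurable_pi_apply i))

lemma coe_measurableEquivIco (s : ℝ) :
    (AddCircle.measurableEquivIco 1 0 (s : UnitAddCircle) : ℝ) = Int.fract s := by
  change ((AddCircle.equivIco 1 0 (s : UnitAddCircle)) : ℝ) = Int.fract s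
  rw [AddCircle.coe_equivIco_mk_apply]
  simp

lemma torusLift_torusMk (x : V3) : torusLift (torusMk x) = x + zlat fun i => -⌊x i⌋ := by
  ext i
  simp only [torusLift, torusMk, coe_measurableEquivIco, zlat, vec3]
  simp [Int.fract, sub_eq_add_neg]

lemma cube3_eq_preimage :
    cube3 = WithLp.ofLp ⁻¹' (Set.univ.pi fun _ : Fin 3 => Set.Icc (0 : ℝ) 1) := by
  ext x
  simp [cube3, Pi.le_def, forall_and]

lemma measurableSet_cube3 : MeasurableSet cube3 := by
  rw [cube3_eq_preimage]
  exact (WithLp.measurable_ofLp 2 _) (MeasurableSet.univ_pi fun _ => measurableSet_Icc)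

lemma measurePreserving_torusMk :
    MeasurePreserving torusMk (volume.restrict cube3) volume := by
  have h1 : MeasurePreserving (@WithLp.ofLp 2 (Fin 3 → ℝ)) (volume.restrict cube3)
      (volume.restrict (Set.univ.pi fun _ : Fin 3 => Set.Icc (0 : ℝ) 1)) := by
    rw [cube3_eq_preimage]
    exact (PiLp.volume_preserving_ofLp (Fin 3)).restrict_preimage
      (MeasurableSet.univ_pi fun _ => measurableSet_Icc)
  have h2 : MeasurePreserving (fun (x : Fin 3 → ℝ) i => (x i : UnitAddCircle))
      (volume.restrict (Set.univ.pi fun _ : Fin 3 => Set.Icc (0 : ℝ) 1)) volume := by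
    have e : (volume.restrict (Set.univ.pi fun _ : Fin 3 => Set.Icc (0 : ℝ) 1)) =
        Measure.pi fun _ : Fin 3 => (volume : Measure ℝ).restrict (Set.Ioc (0 : ℝ) (0 + 1)) := by
      rw [volume_pi, Measure.restrict_pi_pi]
      congr 1
      funext i
      rw [zero_add]
      exact Measure.restrict_congr_set Ioc_ae_eq_Icc.symm
    rw [e]
    exact measurePreserving_pi _ _ fun i => AddCircle.measurePreserving_mk 1 0
  exact h2.comp h1

lemma mem_iff_torusLift {B : Set V3} (hB : ZPer (· ∈ B)) (x : V3) :
    torusLift (torusMk x) ∈ B ↔ x ∈ B := by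
  rw [torusLift_torusMk]
  exact Iff.of_eq (hB x _)

/-- Integer dilations composed with translations preserve the measure of periodic sets. -/
lemma volume_cube3_inter_dilate {B : Set V3} (hm : MeasurableSet B) (hB : ZPer (· ∈ B))
    {N : ℕ} (hN : N ≠ 0) (z : V3) :
    volume (cube3 ∩ {x | (N : ℝ) • x + z ∈ B}) = volume (cube3 ∩ B) := by
  have hm' : MeasurableSet (torusLift ⁻¹' B) := measurable_torusLift hm
  have hd : MeasurePreserving (fun y : UnitAddTorus (Fin 3) => (N : ℤ) • y) volume volume := by
    refine measurePreserving_pi (fun _ : Fin 3 => (volume : Measure UnitAddCircle)) _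
      (f := fun _ => fun y : UnitAddCircle => (N : ℤ) • y) fun i => ?_
    exact Measure.measurePreserving_zsmul (volume : Measure UnitAddCircle) (by exact_mod_cast hN)
  have ht := (measurePreserving_add_right (volume : Measure (UnitAddTorus (Fin 3)))
    (torusMk z)).comp hd
  have h1 : volume (cube3 ∩ B) = volume (torusLift ⁻¹' B) := by
    rw [← measurePreserving_torusMk.measure_preimage hm'.nullMeasurableSet,
      Measure.restrict_apply (measurePreserving_torusMk.measurable hm'), Set.inter_comm]
    congr 2
    ext x
    exact (mem_iff_torusLift hB x).symm
  have h2 := (ht.comp measurePreserving_torusMk)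
  rw [h1, ← h2.measure_preimage hm'.nullMeasurableSet,
      Measure.restrict_apply (h2.measurable hm'), Set.inter_comm]
  congr 2
  ext x
  rw [Set.mem_ofPred_eq, ← mem_iff_torusLift hB]
  simp only [Set.mem_preimage, Function.comp_apply]
  have : torusMk ((N : ℝ) • x + z) = (N : ℤ) • torusMk x + torusMk z := by
    funext i
    simp [torusMk]
  rw [this]

lemma volume_torus_univ : volume (Set.univ : Set (UnitAddTorus (Fin 3))) = 1 := by
  rw [volume_pi, Measure.pi_univ]
  simp

lemma volume_cube3 : volume cube3 = 1 := by
  have := measurePreserving_torusMk.measure_preimage (s := Set.univ)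
    MeasurableSet.univ.nullMeasurableSet
  simpa [volume_torus_univ] using this

/-- Distribution of the phase `x i + x j` on the unit cube. -/
lemma volume_cube3_inter_strip {i j : Fin 3} (hij : i ≠ j) {I : Set ℝ} (hI : MeasurableSet I) :
    volume (cube3 ∩ {x : V3 | Int.fract (x i + x j) ∈ I}) = volume (I ∩ Set.Ico 0 1) := by
  have hI' : MeasurableSet {y : UnitAddCircle | (AddCircle.measurableEquivIco 1 0 y : ℝ) ∈ I} :=
    (measurable_subtype_coe.comp (AddCircle.measurableEquivIco 1 0).measurable) hI
  let f : UnitAddTorus (Fin 3) →+ UnitAddCircle :=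
    Pi.evalAddMonoidHom (fun _ => UnitAddCircle) i + Pi.evalAddMonoidHom (fun _ => UnitAddCircle) j
  have hf : MeasurePreserving f volume volume := by
    refine AddMonoidHom.measurePreserving ?_ ?_ ?_
    · change Continuous fun y : UnitAddTorus (Fin 3) => y i + y j
      fun_prop
    · intro y
      refine ⟨Pi.single i y, ?_⟩
      simp [f, hij.symm]
    · simp [volume_torus_univ]
  have h1 := hf.comp measurePreserving_torusMk
  have h2 : MeasurePreserving (fun s : ℝ => (s : UnitAddCircle))
      (volume.restrict (Set.Ico 0 1)) volume := by
    have := AddCircle.measurePreserving_mk 1 0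
    rwa [zero_add, Measure.restrict_congr_set (Ioc_ae_eq_Icc.trans Ico_ae_eq_Icc.symm)] at this
  have e1 := h1.measure_preimage hI'.nullMeasurableSet
  have e2 := h2.measure_preimage hI'.nullMeasurableSet
  rw [Measure.restrict_apply (h1.measurable hI'), Set.inter_comm] at e1
  rw [Measure.restrict_apply (h2.measurable hI'), ← e1] at e2
  rw [show I ∩ Set.Ico 0 1 = ((fun s : ℝ => (s : UnitAddCircle)) ⁻¹'
    {y : UnitAddCircle | (AddCircle.measurableEquivIco 1 0 y : ℝ) ∈ I}) ∩ Set.Ico 0 1 from ?_, e2]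
  · congr 2
    ext x
    simp only [Set.mem_preimage, Function.comp_apply, Set.mem_ofPred_eq]
    have : f (torusMk x) = ((x i + x j : ℝ) : UnitAddCircle) := by simp [f, torusMk]
    rw [this, coe_measurableEquivIco]
  · ext s
    simp only [Set.mem_inter_iff, Set.mem_preimage, Set.mem_ofPred_eq, coe_measurableEquivIco]
    refine and_congr_left fun hs => ?_
    rw [Int.fract_eq_self.2 hs]

lemma lipschitz_comp_fract {g : ℝ → ℝ} {K : ℝ}
    (hg : ∀ x ∈ Set.Icc (0 : ℝ) 1, ∀ y ∈ Set.Icc (0 : ℝ) 1, |g x - g y| ≤ K * |x - y|)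
    (h01 : g 0 = g 1) (x y : ℝ) :
    |g (Int.fract x) - g (Int.fract y)| ≤ K * |x - y| := by
  have hK : 0 ≤ K := by
    have := hg 0 (by simp) 1 (by simp)
    rw [h01] at this
    simpa using this
  have hI : ∀ s : ℝ, Int.fract s ∈ Set.Icc (0 : ℝ) 1 := fun s =>
    ⟨Int.fract_nonneg s, (Int.fract_lt_one s).le⟩
  wlog hxy : x ≤ y generalizing x y
  · rw [abs_sub_comm, abs_sub_comm x]
    exact this y x (le_of_not_ge hxy)
  rw [abs_of_nonpos (sub_nonpos.2 hxy)]
  have hx := Int.floor_add_fract x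
  have hy := Int.floor_add_fract y
  have hx0 := hI x
  have hy0 := hI y
  rcases (Int.floor_mono hxy).eq_or_lt with h | h
  · refine (hg _ (hI x) _ (hI y)).trans (mul_le_mul_of_nonneg_left ?_ hK)
    rw [← h] at hy
    rw [abs_le]
    constructor <;> linarith
  · have hc : (⌊x⌋ : ℝ) + 1 ≤ ⌊y⌋ := by exact_mod_cast h
    have e1 := hg _ (hI x) 1 (by simp)
    have e2 := hg 0 (by simp) _ (hI y)
    rw [abs_of_nonpos (by linarith [hx0.2] : Int.fract x - 1 ≤ 0)] at e1
    rw [abs_of_nonpos (by linarith [hy0.1] : 0 - Int.fract y ≤ 0)] at e2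
    calc |g (Int.fract x) - g (Int.fract y)|
        = |(g (Int.fract x) - g 1) + (g 0 - g (Int.fract y))| := by rw [h01]; ring_nf
      _ ≤ _ := abs_add_le _ _
      _ ≤ K * -(Int.fract x - 1) + K * -(0 - Int.fract y) := add_le_add e1 e2
      _ = K * (1 - Int.fract x + Int.fract y) := by ring
      _ ≤ K * -(x - y) := mul_le_mul_of_nonneg_left (by linarith) hK

lemma abs_min_sub_min_le {a b c d K : ℝ} (h1 : |a - c| ≤ K) (h2 : |b - d| ≤ K) :
    |min a b - min c d| ≤ K :=
  (abs_min_sub_min_le_max a b c d).trans (max_le h1 h2)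

lemma abs_max_sub_max_le {a b c d K : ℝ} (h1 : |a - c| ≤ K) (h2 : |b - d| ≤ K) :
    |max a b - max c d| ≤ K :=
  (abs_max_sub_max_le_max a b c d).trans (max_le h1 h2)

lemma eventually_fract {p q s : ℝ} (hp : 0 ≤ p) (hq : q ≤ 1) (h1 : p < Int.fract s)
    (h2 : Int.fract s < q) :
    ∀ᶠ r : ℝ in nhds s, Int.fract r = r - ⌊s⌋ ∧ p < Int.fract r ∧ Int.fract r < q := by
  have hs := Int.floor_add_fract s
  filter_upwards [Ioo_mem_nhds (a := (⌊s⌋ : ℝ) + p) (b := ⌊s⌋ + q) (by linarith) (by linarith)]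
    with r hr
  have hfl : ⌊r⌋ = ⌊s⌋ := Int.floor_eq_iff.2 ⟨by linarith [hr.1], by linarith [hr.2]⟩
  have hf : Int.fract r = r - ⌊s⌋ := by rw [← Int.self_sub_floor, hfl]
  rw [hf]
  exact ⟨rfl, by linarith [hr.1], by linarith [hr.2]⟩

/-- A piecewise affine cutoff function supported in `[a, b]`. -/
lemma exists_cutoff {a b δ : ℝ} (ha : 0 ≤ a) (hb : b ≤ 1) (hδ : 0 < δ) :
    ∃ ψ : ℝ → ℝ, (∀ s (n : ℤ), ψ (s + n) = ψ s) ∧ (∀ s, |ψ s| ≤ 1) ∧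
      (∀ x y, |ψ x - ψ y| ≤ 1 / δ * |x - y|) ∧
      (∀ s, a + δ < Int.fract s → Int.fract s < b - δ → ψ s = 1) ∧
      (∀ s, Int.fract s ≤ a ∨ b ≤ Int.fract s → ψ s = 0) := by
  set g : ℝ → ℝ := fun f => max 0 (min 1 (min ((f - a) / δ) ((b - f) / δ))) with hgdef
  have hz : ∀ f, f ≤ a ∨ b ≤ f → g f = 0 := by
    intro f hf
    refine max_eq_left ((min_le_right _ _).trans ?_)
    rcases hf with h | h
    · exact (min_le_left _ _).trans (div_nonpos_of_nonpos_of_nonneg (by linarith) hδ.le)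
    · exact (min_le_right _ _).trans (div_nonpos_of_nonpos_of_nonneg (by linarith) hδ.le)
  refine ⟨fun s => g (Int.fract s), fun s n => by simp, fun s => ?_, ?_, fun s h1 h2 => ?_,
    fun s h => hz _ h⟩
  · rw [abs_of_nonneg (le_max_left _ _)]
    exact max_le zero_le_one (min_le_left _ _)
  · refine lipschitz_comp_fract (fun x _ y _ => ?_)
      ((hz 0 (Or.inl ha)).trans (hz 1 (Or.inr hb)).symm)
    have h0 : 0 ≤ 1 / δ * |x - y| := by positivity
    refine abs_max_sub_max_le (by simpa using h0)
      (abs_min_sub_min_le (by simpa using h0) (abs_min_sub_min_le ?_ ?_))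
    · rw [← sub_div, abs_div, abs_of_pos hδ, sub_sub_sub_cancel_right, div_eq_inv_mul, one_div]
    · rw [← sub_div, abs_div, abs_of_pos hδ, sub_sub_sub_cancel_left, abs_sub_comm y,
        div_eq_inv_mul, one_div]
  · have e1 : 1 ≤ (Int.fract s - a) / δ := by rw [le_div_iff₀ hδ]; linarith
    have e2 : 1 ≤ (b - Int.fract s) / δ := by rw [le_div_iff₀ hδ]; linarith
    simp [hgdef, min_eq_left (le_min e1 e2)]

/-- The periodic sawtooth with slopes `1 - t` on `(0, t)` and `-t` on `(t, 1)`. -/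
lemma exists_sawtooth {t : ℝ} (ht0 : 0 ≤ t) (ht1 : t ≤ 1) :
    ∃ H : ℝ → ℝ, (∀ s (n : ℤ), H (s + n) = H s) ∧ (∀ s, |H s| ≤ 1) ∧
      (∀ x y, |H x - H y| ≤ |x - y|) ∧
      (∀ s, 0 < Int.fract s → Int.fract s < t → HasDerivAt H (1 - t) s) ∧
      (∀ s, t < Int.fract s → HasDerivAt H (-t) s) := by
  set g : ℝ → ℝ := fun f => min ((1 - t) * f) (t * (1 - f)) with hgdef
  refine ⟨fun s => g (Int.fract s), fun s n => by simp, fun s => ?_, ?_, fun s h1 h2 => ?_,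
    fun s h1 => ?_⟩
  · have h0 := Int.fract_nonneg s
    have h1 := (Int.fract_lt_one s).le
    rw [abs_of_nonneg (le_min (mul_nonneg (by linarith) h0) (mul_nonneg ht0 (by linarith)))]
    exact (min_le_left _ _).trans (by nlinarith)
  · have := lipschitz_comp_fract (g := g) (K := 1) (fun x _ y _ => ?_) ?_
    · simpa using this
    · refine abs_min_sub_min_le ?_ ?_
      · rw [← mul_sub, abs_mul, abs_of_nonneg (by linarith : 0 ≤ 1 - t)]
        exact mul_le_mul_of_nonneg_right (by linarith) (abs_nonneg _)
      · rw [← mul_sub, abs_mul, abs_of_nonneg ht0, sub_sub_sub_cancel_left, abs_sub_comm y]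
        exact mul_le_mul_of_nonneg_right (by linarith) (abs_nonneg _)
    · simp [hgdef, ht0, ht1]
  · have : HasDerivAt (fun r : ℝ => (1 - t) * (r - ⌊s⌋)) (1 - t) s := by
      simpa using ((hasDerivAt_id s).sub_const (⌊s⌋ : ℝ)).const_mul (1 - t)
    refine this.congr_of_eventuallyEq ?_
    filter_upwards [eventually_fract le_rfl ht1 h1 h2] with r hr
    simp only [hgdef]
    rw [min_eq_left (by nlinarith), hr.1]
  · have : HasDerivAt (fun r : ℝ => t * (1 - (r - ⌊s⌋))) (-t) s := by
      simpa using (((hasDerivAt_id s).sub_const (⌊s⌋ : ℝ)).const_sub 1).const_mul t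
    refine this.congr_of_eventuallyEq ?_
    filter_upwards [eventually_fract ht0 le_rfl h1 (Int.fract_lt_one s)] with r hr
    simp only [hgdef]
    rw [min_eq_right (by nlinarith), hr.1]

instance : IsProbabilityMeasure ((volume : Measure V3).restrict cube3) :=
  ⟨by rw [Measure.restrict_apply_univ, volume_cube3]⟩

lemma measurable_coord (i : Fin 3) : Measurable fun x : V3 => x i :=
  (measurable_pi_apply i).comp (WithLp.measurable_ofLp 2 _)

lemma measurable_phase (i j : Fin 3) : Measurable fun x : V3 => Int.fract (x i + x j) :=
  ((measurable_coord i).add (measurable_coord j)).fract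

lemma lintegral_section {P B : Set V3} (hP : MeasurableSet P) (hm : MeasurableSet B)
    (hB : ZPer (· ∈ B)) (N : ℕ) :
    Measurable (fun z => volume.restrict cube3 {x | x ∈ P ∧ (N : ℝ) • x + z ∈ B}) ∧
    ∫⁻ z, volume.restrict cube3 {x | x ∈ P ∧ (N : ℝ) • x + z ∈ B} ∂(volume.restrict cube3) =
      volume (cube3 ∩ P) * volume (cube3 ∩ B) := by
  have hS : MeasurableSet {p : V3 × V3 | p.2 ∈ P ∧ (N : ℝ) • p.2 + p.1 ∈ B} :=
    (measurable_snd hP).inter (((measurable_snd.const_smul (N : ℝ)).add measurable_fst) hm)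
  refine ⟨measurable_measure_prodMk_left hS, ?_⟩
  have h1 := Measure.prod_apply (μ := (volume : Measure V3).restrict cube3)
    (ν := (volume : Measure V3).restrict cube3) hS
  have h2 := Measure.prod_apply_symm (μ := (volume : Measure V3).restrict cube3)
    (ν := (volume : Measure V3).restrict cube3) hS
  refine h1.symm.trans (h2.trans ?_)
  have h3 : ∀ x, volume.restrict cube3 ((fun z => (z, x)) ⁻¹'
      {p : V3 × V3 | p.2 ∈ P ∧ (N : ℝ) • p.2 + p.1 ∈ B}) =
        P.indicator (fun _ => volume (cube3 ∩ B)) x := by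
    intro x
    rw [Measure.restrict_apply (measurable_prodMk_right hS), Set.inter_comm]
    by_cases hx : x ∈ P
    · rw [Set.indicator_of_mem hx, ← volume_cube3_inter_dilate hm hB one_ne_zero ((N : ℝ) • x)]
      congr 2
      ext z
      simp [hx, add_comm]
    · rw [Set.indicator_of_notMem hx]
      simp [hx]
  simp_rw [h3]
  rw [lintegral_indicator_const hP, Measure.restrict_apply hP, Set.inter_comm P, mul_comm]

lemma volume_phase_lt {i j : Fin 3} (hij : i ≠ j) {t : ℝ} (ht1 : t ≤ 1) :
    volume (cube3 ∩ {x : V3 | Int.fract (x i + x j) < t}) = ENNReal.ofReal t := by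
  rw [show {x : V3 | Int.fract (x i + x j) < t} = {x : V3 | Int.fract (x i + x j) ∈ Set.Iio t}
    from rfl, volume_cube3_inter_strip hij measurableSet_Iio,
    show Set.Iio t ∩ Set.Ico 0 1 = Set.Ico 0 t from ?_]
  · simp
  · ext s
    simp only [Set.mem_inter_iff, Set.mem_Iio, Set.mem_Ico]
    exact ⟨fun h => ⟨h.2.1, h.1⟩, fun h => ⟨h.2, h.1, h.2.trans_le ht1⟩⟩

lemma volume_phase_ge {i j : Fin 3} (hij : i ≠ j) {t : ℝ} (ht0 : 0 ≤ t) :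
    volume (cube3 ∩ {x : V3 | t ≤ Int.fract (x i + x j)}) = ENNReal.ofReal (1 - t) := by
  rw [show {x : V3 | t ≤ Int.fract (x i + x j)} = {x : V3 | Int.fract (x i + x j) ∈ Set.Ici t}
    from rfl, volume_cube3_inter_strip hij measurableSet_Ici,
    show Set.Ici t ∩ Set.Ico 0 1 = Set.Ico t 1 from ?_]
  · simp
  · ext s
    simp only [Set.mem_inter_iff, Set.mem_Ici, Set.mem_Ico]
    exact ⟨fun h => ⟨h.1, h.2.2⟩, fun h => ⟨h.1, ht0.trans h.1, h.2⟩⟩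

/-- A translation of the fine scale for which the bad sets are at most as large as on average. -/
lemma exists_shift {i j : Fin 3} (hij : i ≠ j) {t : ℝ} (ht0 : 0 ≤ t) (ht1 : t ≤ 1)
    {A B : Set V3} (hAm : MeasurableSet A) (hA : ZPer (· ∈ A)) (hBm : MeasurableSet B)
    (hB : ZPer (· ∈ B)) (N : ℕ) :
    ∃ z : V3,
      volume (cube3 ∩ {x : V3 | Int.fract (x i + x j) < t ∧ (N : ℝ) • x + z ∈ A}) +
      volume (cube3 ∩ {x : V3 | t ≤ Int.fract (x i + x j) ∧ (N : ℝ) • x + z ∈ B}) ≤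
      ENNReal.ofReal t * volume (cube3 ∩ A) + ENNReal.ofReal (1 - t) * volume (cube3 ∩ B) := by
  have hP : MeasurableSet {x : V3 | Int.fract (x i + x j) < t} :=
    measurable_phase i j measurableSet_Iio
  have hQ : MeasurableSet {x : V3 | t ≤ Int.fract (x i + x j)} :=
    measurable_phase i j measurableSet_Ici
  obtain ⟨m1, e1⟩ := lintegral_section hP hAm hA N
  obtain ⟨m2, e2⟩ := lintegral_section hQ hBm hB N
  obtain ⟨z, hz⟩ := exists_le_lintegral (μ := (volume : Measure V3).restrict cube3)
    (m1.add m2).aemeasurable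
  refine ⟨z, ?_⟩
  simp only [Pi.add_apply] at hz
  rw [lintegral_add_left m1, e1, e2, volume_phase_lt hij ht1, volume_phase_ge hij ht0,
    Measure.restrict_apply' measurableSet_cube3, Measure.restrict_apply' measurableSet_cube3,
    Set.inter_comm, Set.inter_comm _ cube3] at hz
  exact hz

/-- The phases within distance `δ` of an interface of a laminate of volume fraction `t`. -/
def transition (t δ : ℝ) : Set ℝ := Set.Iic δ ∪ Set.Icc (t - δ) (t + δ) ∪ Set.Ici (1 - δ)

lemma measurableSet_transition (t δ : ℝ) : MeasurableSet (transition t δ) :=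
  (measurableSet_Iic.union measurableSet_Icc).union measurableSet_Ici

lemma volume_cube3_inter_transition {i j : Fin 3} (hij : i ≠ j) (t : ℝ) {δ : ℝ} (hδ : 0 ≤ δ) :
    volume (cube3 ∩ {x : V3 | Int.fract (x i + x j) ∈ transition t δ}) ≤
      ENNReal.ofReal (4 * δ) := by
  rw [volume_cube3_inter_strip hij (measurableSet_transition t δ)]
  have : transition t δ ∩ Set.Ico 0 1 ⊆
      Set.Icc 0 δ ∪ Set.Icc (t - δ) (t + δ) ∪ Set.Icc (1 - δ) 1 := by
    rintro s ⟨(h | h) | h, h'⟩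
    · exact Or.inl (Or.inl ⟨h'.1, h⟩)
    · exact Or.inl (Or.inr h)
    · exact Or.inr ⟨h, h'.2.le⟩
  refine (measure_mono this).trans ((measure_union_le _ _).trans
    ((add_le_add_left (measure_union_le _ _) _).trans ?_))
  rw [Real.volume_Icc, Real.volume_Icc, Real.volume_Icc, ← ENNReal.ofReal_add (by linarith)
    (by linarith), ← ENNReal.ofReal_add (by linarith) (by linarith)]
  exact ENNReal.ofReal_le_ofReal (by linarith)

/-- A shift by `h` changes the side of the interface only close to the interfaces. -/
lemma fract_mem_transition_of_lt_iff_ne {t s h : ℝ}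
    (hne : ¬(Int.fract (s + h) < t ↔ Int.fract s < t)) :
    Int.fract s ∈ transition t |h| := by
  by_contra hn
  simp only [transition, Set.mem_union, Set.mem_Iic, Set.mem_Icc, Set.mem_Ici, not_or, not_le,
    not_and_or] at hn
  obtain ⟨⟨h1, h2⟩, h3⟩ := hn
  have ha := neg_abs_le h
  have hb := le_abs_self h
  have hs := Int.floor_add_fract s
  have hfl : ⌊s + h⌋ = ⌊s⌋ := Int.floor_eq_iff.2 ⟨by linarith, by linarith⟩
  have hf : Int.fract (s + h) = Int.fract s + h := by
    rw [← Int.self_sub_floor, hfl]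
    linarith
  rw [hf] at hne
  apply hne
  rcases h2 with h2 | h2
  · exact ⟨fun _ => by linarith, fun _ => by linarith⟩
  · exact ⟨fun _ => by linarith, fun _ => by linarith⟩

/-- The periodic displacement `v` and the phase indicator `χ` realise the wells `W` with mean
strain `E` outside the periodic set `bad`. -/
structure Realises (W : Fin 3 → Matrix (Fin 3) (Fin 3) ℝ) (M : ℝ) (E : Matrix (Fin 3) (Fin 3) ℝ)
    (β L S : ℝ) (v : V3 → V3) (χ : V3 → Fin 3) (bad : Set V3) : Prop where
  zper : ZPer v
  norm_le : ∀ x, ‖v x‖ ≤ M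
  lipschitz : ∀ x y, ‖v x - v y‖ ≤ L * ‖x - y‖
  zper_phase : ZPer χ
  measurable_phase : Measurable χ
  zper_bad : ZPer (· ∈ bad)
  measurableSet_bad : MeasurableSet bad
  strain : ∀ x ∉ bad, ∃ D : V3 →L[ℝ] V3, HasFDerivAt v D x ∧ ∀ p q,
    E p q + (D (EuclideanSpace.single q 1) p + D (EuclideanSpace.single p 1) q) / 2 = W (χ x) p q
  beta_nonneg : 0 ≤ β
  volume_bad : volume (cube3 ∩ bad) ≤ ENNReal.ofReal β
  S_nonneg : 0 ≤ S
  volume_shift : ∀ h, volume (cube3 ∩ {x | χ (x + h) ≠ χ x}) ≤ ENNReal.ofReal (S * ‖h‖)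

/-- Existence of a microstructure with mean strain `E`, bad set of measure at most `β`, Lipschitz
constant `L` and perimeter bound `S`. -/
def Approx (W : Fin 3 → Matrix (Fin 3) (Fin 3) ℝ) (M : ℝ) (E : Matrix (Fin 3) (Fin 3) ℝ)
    (β L S : ℝ) : Prop :=
  ∃ v χ bad, Realises W M E β L S v χ bad

lemma Approx.mono {W : Fin 3 → Matrix (Fin 3) (Fin 3) ℝ} {M : ℝ} {E : Matrix (Fin 3) (Fin 3) ℝ}
    {β L S β' L' S' : ℝ} (h : Approx W M E β L S) (hβ : β ≤ β') (hL : L ≤ L') (hS : S ≤ S') :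
    Approx W M E β' L' S' := by
  obtain ⟨v, χ, bad, h⟩ := h
  exact ⟨v, χ, bad, { h with
    lipschitz := fun x y => (h.lipschitz x y).trans
      (mul_le_mul_of_nonneg_right hL (norm_nonneg _))
    beta_nonneg := h.beta_nonneg.trans hβ
    volume_bad := h.volume_bad.trans (ENNReal.ofReal_le_ofReal hβ)
    S_nonneg := h.S_nonneg.trans hS
    volume_shift := fun k => (h.volume_shift k).trans
      (ENNReal.ofReal_le_ofReal (mul_le_mul_of_nonneg_right hS (norm_nonneg _))) }⟩

lemma approx_trivial (W : Fin 3 → Matrix (Fin 3) (Fin 3) ℝ) {M : ℝ} (hM : 0 ≤ M)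
    (E : Matrix (Fin 3) (Fin 3) ℝ) : Approx W M E 1 0 0 :=
  ⟨0, 0, Set.univ, {
    zper := fun _ _ => rfl
    norm_le := fun _ => by simpa using hM
    lipschitz := fun _ _ => by simp
    zper_phase := fun _ _ => rfl
    measurable_phase := measurable_const
    zper_bad := fun _ _ => rfl
    measurableSet_bad := MeasurableSet.univ
    strain := fun x hx => absurd (Set.mem_univ x) hx
    beta_nonneg := zero_le_one
    volume_bad := by simp [volume_cube3]
    S_nonneg := le_rfl
    volume_shift := fun _ => by simp }⟩

lemma approx_well (W : Fin 3 → Matrix (Fin 3) (Fin 3) ℝ) {M : ℝ} (hM : 0 ≤ M) (k : Fin 3) :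
    Approx W M (W k) 0 0 0 :=
  ⟨0, fun _ => k, ∅, {
    zper := fun _ _ => rfl
    norm_le := fun _ => by simpa using hM
    lipschitz := fun _ _ => by simp
    zper_phase := fun _ _ => rfl
    measurable_phase := measurable_const
    zper_bad := fun _ _ => rfl
    measurableSet_bad := MeasurableSet.empty
    strain := fun x _ => ⟨0, hasFDerivAt_const 0 x, fun p q => by simp⟩
    beta_nonneg := le_rfl
    volume_bad := by simp
    S_nonneg := le_rfl
    volume_shift := fun _ => by simp }⟩

/-- The functional `x ↦ x i + x j`. -/
def phaseCLM (i j : Fin 3) : V3 →L[ℝ] ℝ := EuclideanSpace.proj i + EuclideanSpace.proj j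

lemma phaseCLM_apply (i j : Fin 3) (x : V3) : phaseCLM i j x = x i + x j := rfl

lemma abs_phaseCLM_le (i j : Fin 3) (x : V3) : |phaseCLM i j x| ≤ 2 * ‖x‖ := by
  rw [phaseCLM_apply]
  have h1 := PiLp.norm_apply_le x i
  have h2 := PiLp.norm_apply_le x j
  rw [Real.norm_eq_abs] at h1 h2
  linarith [abs_add_le (x i) (x j)]

/-- The amplitude direction `e_i - e_j` of the laminates. -/
def amplitude (i j : Fin 3) : V3 := EuclideanSpace.single i 1 - EuclideanSpace.single j 1

lemma norm_amplitude_le (i j : Fin 3) : ‖amplitude i j‖ ≤ 2 := by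
  refine (norm_sub_le _ _).trans ?_
  simp
  norm_num

lemma symmetrized_amplitude {i j : Fin 3} (hij : i ≠ j) (p q : Fin 3) :
    (phaseCLM i j (EuclideanSpace.single q 1) * amplitude i j p +
      phaseCLM i j (EuclideanSpace.single p 1) * amplitude i j q) / 2 =
    Matrix.diagonal (Pi.single i 1 - Pi.single j 1 : Fin 3 → ℝ) p q := by
  simp only [phaseCLM_apply, amplitude]
  fin_cases i <;> fin_cases j <;> first | exact absurd rfl hij | skip
  all_goals fin_cases p <;> fin_cases q <;> simp

lemma phase_add_zlat (i j : Fin 3) (x : V3) (n : Fin 3 → ℤ) :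
    phaseCLM i j (x + zlat n) = phaseCLM i j x + ((n i + n j : ℤ) : ℝ) := by
  simp [phaseCLM_apply, zlat, vec3]
  ring

lemma zlat_dilate (N : ℕ) (x z : V3) (n : Fin 3 → ℤ) :
    (N : ℝ) • (x + zlat n) + z = ((N : ℝ) • x + z) + zlat fun k => (N : ℤ) * n k := by
  ext k
  simp [zlat, vec3]
  ring

/-- Laminate with profile `H` at unit scale and two microstructures, cut off by `ψ` and `ψ'`,
at scale `1 / N`. -/
def lamMap (i j : Fin 3) (c : ℝ) (N : ℕ) (z : V3) (H ψ ψ' : ℝ → ℝ) (v v' : V3 → V3) (x : V3) : V3 :=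
  (c * H (phaseCLM i j x)) • amplitude i j +
    (N : ℝ)⁻¹ • (ψ (phaseCLM i j x) • v ((N : ℝ) • x + z) +
      ψ' (phaseCLM i j x) • v' ((N : ℝ) • x + z))

lemma lamMap_swap (i j : Fin 3) (c : ℝ) (N : ℕ) (z : V3) (H ψ ψ' : ℝ → ℝ) (v v' : V3 → V3) :
    lamMap i j c N z H ψ ψ' v v' = lamMap i j c N z H ψ' ψ v' v := by
  funext x
  rw [lamMap, lamMap, add_comm (ψ _ • _)]

lemma hasFDerivAt_lamMap {i j : Fin 3} {c : ℝ} {N : ℕ} (hN : N ≠ 0) {z : V3} {H ψ ψ' : ℝ → ℝ}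
    {v v' : V3 → V3} {x : V3} {h : ℝ} {D : V3 →L[ℝ] V3}
    (hH : HasDerivAt H h (phaseCLM i j x))
    (hψ : ∀ᶠ r in nhds (phaseCLM i j x), ψ r = 1 ∧ ψ' r = 0)
    (hD : HasFDerivAt v D ((N : ℝ) • x + z)) :
    HasFDerivAt (lamMap i j c N z H ψ ψ' v v')
      ((c * h) • (phaseCLM i j).smulRight (amplitude i j) + D) x := by
  have hN' : (N : ℝ) ≠ 0 := by exact_mod_cast hN
  have h1 : HasFDerivAt (fun y => (c * H (phaseCLM i j y)) • amplitude i j)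
      ((c * h) • (phaseCLM i j).smulRight (amplitude i j)) x := by
    have := ((hH.comp_hasFDerivAt x (phaseCLM i j).hasFDerivAt).const_mul c).smul_const
      (amplitude i j)
    refine this.congr_fderiv ?_
    ext y
    simp [mul_assoc, mul_comm, mul_left_comm]
  have h2 : HasFDerivAt (fun y => (N : ℝ)⁻¹ • v ((N : ℝ) • y + z)) D x := by
    have hin : HasFDerivAt (fun y : V3 => (N : ℝ) • y + z)
        ((N : ℝ) • ContinuousLinearMap.id ℝ V3) x :=
      ((hasFDerivAt_id x).const_smul (N : ℝ)).add_const z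
    refine ((hD.comp x hin).const_smul (N : ℝ)⁻¹).congr_fderiv ?_
    ext y
    simp [hN']
  refine (h1.add h2).congr_of_eventuallyEq ?_
  filter_upwards [(phaseCLM i j).continuous.continuousAt.eventually hψ] with y hy
  simp [lamMap, hy.1, hy.2]

lemma norm_cutoff_sub_le {i j : Fin 3} {N : ℕ} {z : V3} {ψ : ℝ → ℝ} {v : V3 → V3} {δ M L : ℝ}
    (hδ : 0 < δ) (hψ : ∀ s, |ψ s| ≤ 1) (hψl : ∀ x y, |ψ x - ψ y| ≤ 1 / δ * |x - y|)
    (hM : ∀ x, ‖v x‖ ≤ M) (hL : ∀ x y, ‖v x - v y‖ ≤ L * ‖x - y‖) (x y : V3) :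
    ‖ψ (phaseCLM i j x) • v ((N : ℝ) • x + z) - ψ (phaseCLM i j y) • v ((N : ℝ) • y + z)‖ ≤
      (2 * M / δ + N * L) * ‖x - y‖ := by
  have e : ψ (phaseCLM i j x) • v ((N : ℝ) • x + z) - ψ (phaseCLM i j y) • v ((N : ℝ) • y + z) =
      (ψ (phaseCLM i j x) - ψ (phaseCLM i j y)) • v ((N : ℝ) • x + z) +
      ψ (phaseCLM i j y) • (v ((N : ℝ) • x + z) - v ((N : ℝ) • y + z)) := by
    rw [sub_smul, smul_sub]
    abel
  have h1 : |ψ (phaseCLM i j x) - ψ (phaseCLM i j y)| ≤ 1 / δ * (2 * ‖x - y‖) := by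
    refine (hψl _ _).trans (mul_le_mul_of_nonneg_left ?_ (by positivity))
    rw [← map_sub]
    exact abs_phaseCLM_le i j _
  have h2 : ‖v ((N : ℝ) • x + z) - v ((N : ℝ) • y + z)‖ ≤ N * L * ‖x - y‖ := by
    refine (hL _ _).trans_eq ?_
    rw [add_sub_add_right_eq_sub, ← smul_sub, norm_smul, Real.norm_natCast]
    ring
  rw [e]
  refine (norm_add_le _ _).trans ?_
  rw [norm_smul, norm_smul, Real.norm_eq_abs, Real.norm_eq_abs]
  calc _ ≤ 1 / δ * (2 * ‖x - y‖) * M + 1 * (N * L * ‖x - y‖) :=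
        add_le_add (mul_le_mul h1 (hM _) (norm_nonneg _) (by positivity))
          (mul_le_mul (hψ _) h2 (norm_nonneg _) zero_le_one)
    _ = _ := by ring

/-- Laminating two approximable strains that are compatible along a coordinate shear direction. -/
theorem Approx.laminate {W : Fin 3 → Matrix (Fin 3) (Fin 3) ℝ} {M : ℝ}
    {A B : Matrix (Fin 3) (Fin 3) ℝ} {βA βB LA LB SA SB : ℝ}
    (hA : Approx W M A βA LA SA) (hB : Approx W M B βB LB SB) {i j : Fin 3} (hij : i ≠ j) {c : ℝ}
    (hc : 4 * |c| ≤ M) (hAB : A - B = c • Matrix.diagonal (Pi.single i 1 - Pi.single j 1))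
    {t : ℝ} (ht0 : 0 ≤ t) (ht1 : t ≤ 1) {δ : ℝ} (hδ : 0 < δ) {N : ℕ} (hN : 4 ≤ N)
    (hNδ : 1 ≤ N * δ) :
    Approx W M (t • A + (1 - t) • B) (t * βA + (1 - t) * βB + 4 * δ) (5 * M + LA + LB)
      (8 + N * (SA + SB)) := by
  obtain ⟨v, χ, bad, hA⟩ := hA
  obtain ⟨v', χ', bad', hB⟩ := hB
  have hM : 0 ≤ M := le_trans (by positivity) hc
  have hN0 : N ≠ 0 := by omega
  have hN4 : (4 : ℝ) ≤ N := by exact_mod_cast hN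
  have hNpos : (0 : ℝ) < N := by linarith
  obtain ⟨z, hz⟩ := exists_shift hij ht0 ht1 hA.measurableSet_bad hA.zper_bad
    hB.measurableSet_bad hB.zper_bad N
  obtain ⟨H, Hper, Hle, Hlip, HdA, HdB⟩ := exists_sawtooth ht0 ht1
  obtain ⟨ψ, ψper, ψle, ψlip, ψone, ψzero⟩ := exists_cutoff le_rfl ht1 hδ
  obtain ⟨ψ', ψper', ψle', ψlip', ψone', ψzero'⟩ := exists_cutoff ht0 le_rfl hδ
  have hABe : ∀ p q, A p q - B p q =
      c * Matrix.diagonal (Pi.single i 1 - Pi.single j 1 : Fin 3 → ℝ) p q := fun p q => by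
    simpa using congrFun (congrFun hAB p) q
  have hdil : Measurable fun x : V3 => (N : ℝ) • x + z := by fun_prop
  have hphase : Measurable fun x : V3 => Int.fract (phaseCLM i j x) := measurable_phase i j
  refine ⟨lamMap i j c N z H ψ ψ' v v',
    fun x => if Int.fract (phaseCLM i j x) < t then χ ((N : ℝ) • x + z)
      else χ' ((N : ℝ) • x + z),
    {x | Int.fract (phaseCLM i j x) ∈ transition t δ} ∪
      ({x | Int.fract (phaseCLM i j x) < t ∧ (N : ℝ) • x + z ∈ bad} ∪
      {x | t ≤ Int.fract (phaseCLM i j x) ∧ (N : ℝ) • x + z ∈ bad'}), ?_⟩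
  constructor
  · intro x n
    simp only [lamMap, phase_add_zlat, zlat_dilate, Hper, ψper, ψper', hA.zper _, hB.zper _]
  · intro x
    have h1 : ‖(c * H (phaseCLM i j x)) • amplitude i j‖ ≤ 2 * |c| := by
      rw [norm_smul, Real.norm_eq_abs, abs_mul]
      have := mul_le_mul (mul_le_mul_of_nonneg_left (Hle (phaseCLM i j x)) (abs_nonneg c))
        (norm_amplitude_le i j) (norm_nonneg _) (by positivity)
      linarith
    have h2 : ‖ψ (phaseCLM i j x) • v ((N : ℝ) • x + z)‖ ≤ M := by
      rw [norm_smul, Real.norm_eq_abs]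
      exact (mul_le_mul (ψle _) (hA.norm_le _) (norm_nonneg _) zero_le_one).trans_eq (one_mul M)
    have h3 : ‖ψ' (phaseCLM i j x) • v' ((N : ℝ) • x + z)‖ ≤ M := by
      rw [norm_smul, Real.norm_eq_abs]
      exact (mul_le_mul (ψle' _) (hB.norm_le _) (norm_nonneg _) zero_le_one).trans_eq (one_mul M)
    refine (norm_add_le _ _).trans ?_
    rw [norm_smul (N : ℝ)⁻¹, norm_inv, Real.norm_natCast]
    have h4 : (N : ℝ)⁻¹ * ‖ψ (phaseCLM i j x) • v ((N : ℝ) • x + z) +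
        ψ' (phaseCLM i j x) • v' ((N : ℝ) • x + z)‖ ≤ 4⁻¹ * (M + M) :=
      mul_le_mul (inv_anti₀ (by norm_num) hN4) ((norm_add_le _ _).trans (add_le_add h2 h3))
        (norm_nonneg _) (by norm_num)
    linarith
  · intro x y
    have h1 : ‖(c * H (phaseCLM i j x)) • amplitude i j -
        (c * H (phaseCLM i j y)) • amplitude i j‖ ≤ M * ‖x - y‖ := by
      rw [← sub_smul, ← mul_sub, norm_smul, Real.norm_eq_abs, abs_mul]
      have e := (Hlip (phaseCLM i j x) (phaseCLM i j y))
      rw [← map_sub] at e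
      have := mul_le_mul (mul_le_mul_of_nonneg_left (e.trans (abs_phaseCLM_le i j _))
        (abs_nonneg c)) (norm_amplitude_le i j) (norm_nonneg _) (by positivity)
      have := mul_le_mul_of_nonneg_right hc (norm_nonneg (x - y))
      linarith
    have h2 := norm_cutoff_sub_le (i := i) (j := j) (N := N) (z := z) hδ ψle ψlip hA.norm_le
      hA.lipschitz x y
    have h3 := norm_cutoff_sub_le (i := i) (j := j) (N := N) (z := z) hδ ψle' ψlip' hB.norm_le
      hB.lipschitz x y
    have e : lamMap i j c N z H ψ ψ' v v' x - lamMap i j c N z H ψ ψ' v v' y =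
        ((c * H (phaseCLM i j x)) • amplitude i j - (c * H (phaseCLM i j y)) • amplitude i j) +
        (N : ℝ)⁻¹ • ((ψ (phaseCLM i j x) • v ((N : ℝ) • x + z) -
            ψ (phaseCLM i j y) • v ((N : ℝ) • y + z)) +
          (ψ' (phaseCLM i j x) • v' ((N : ℝ) • x + z) -
            ψ' (phaseCLM i j y) • v' ((N : ℝ) • y + z))) := by
      simp only [lamMap, smul_add, smul_sub]
      abel
    have h4 : (N : ℝ)⁻¹ * (2 * M / δ) ≤ 2 * M := by
      rw [inv_mul_le_iff₀ hNpos, div_le_iff₀ hδ]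
      nlinarith
    rw [e]
    refine (norm_add_le _ _).trans ?_
    rw [norm_smul (N : ℝ)⁻¹, norm_inv, Real.norm_natCast]
    calc _ ≤ M * ‖x - y‖ + (N : ℝ)⁻¹ * ((2 * M / δ + N * LA) * ‖x - y‖ +
          (2 * M / δ + N * LB) * ‖x - y‖) :=
          add_le_add h1 (mul_le_mul_of_nonneg_left ((norm_add_le _ _).trans (add_le_add h2 h3))
            (by positivity))
      _ = (M + 2 * ((N : ℝ)⁻¹ * (2 * M / δ)) + LA + LB) * ‖x - y‖ := by
          field_simp
          ring
      _ ≤ _ := mul_le_mul_of_nonneg_right (by linarith) (norm_nonneg _)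
  · intro x n
    simp only [phase_add_zlat, zlat_dilate, Int.fract_add_intCast, hA.zper_phase _,
      hB.zper_phase _]
  · exact Measurable.ite (hphase measurableSet_Iio) (hA.measurable_phase.comp hdil)
      (hB.measurable_phase.comp hdil)
  · intro x n
    have e1 := hA.zper_bad ((N : ℝ) • x + z) fun k => (N : ℤ) * n k
    have e2 := hB.zper_bad ((N : ℝ) • x + z) fun k => (N : ℤ) * n k
    simp only [Set.mem_union, Set.mem_ofPred_eq, phase_add_zlat, zlat_dilate,
      Int.fract_add_intCast] at e1 e2 ⊢
    rw [e1, e2]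
  · exact (hphase (measurableSet_transition t δ)).union
      (((hphase measurableSet_Iio).inter (hdil hA.measurableSet_bad)).union
      ((hphase measurableSet_Ici).inter (hdil hB.measurableSet_bad)))
  · intro x hx
    simp only [Set.mem_union, Set.mem_ofPred_eq, not_or, not_and] at hx
    obtain ⟨hT, hbA, hbB⟩ := hx
    simp only [transition, Set.mem_union, Set.mem_Iic, Set.mem_Icc, Set.mem_Ici, not_or, not_le,
      not_and] at hT
    obtain ⟨⟨hT1, hT2⟩, hT3⟩ := hT
    by_cases hlt : Int.fract (phaseCLM i j x) < t
    · have hlt' : Int.fract (phaseCLM i j x) < t - δ := by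
        by_contra hcon
        linarith [hT2 (not_lt.1 hcon)]
      obtain ⟨D, hD, hDs⟩ := hA.strain _ (hbA hlt)
      refine ⟨_, hasFDerivAt_lamMap hN0 (HdA _ (hδ.trans hT1) hlt) ?_ hD, fun p q => ?_⟩
      · filter_upwards [eventually_fract hδ.le (by linarith) hT1 hlt'] with r hr
        exact ⟨ψone r (by linarith [hr.2.1]) hr.2.2, ψzero' r (Or.inl (by linarith [hr.2.2]))⟩
      · rw [if_pos hlt, ← hDs p q]
        have e1 := symmetrized_amplitude hij p q
        have e2 := hABe p q
        simp only [Matrix.add_apply, Matrix.smul_apply, smul_eq_mul, _root_.add_apply,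
          _root_.smul_apply, ContinuousLinearMap.smulRight_apply, PiLp.add_apply,
          PiLp.smul_apply]
        linear_combination c * (1 - t) * e1 - (1 - t) * e2
    · have hge := not_lt.1 hlt
      have hge' : t + δ < Int.fract (phaseCLM i j x) := hT2 (by linarith)
      obtain ⟨D, hD, hDs⟩ := hB.strain _ (hbB hge)
      rw [lamMap_swap]
      refine ⟨_, hasFDerivAt_lamMap hN0 (HdB _ (by linarith)) ?_ hD, fun p q => ?_⟩
      · filter_upwards [eventually_fract (by linarith) (by linarith) hge' hT3] with r hr
        exact ⟨ψone' r hr.2.1 hr.2.2, ψzero r (Or.inr (by linarith [hr.2.1]))⟩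
      · rw [if_neg hlt, ← hDs p q]
        have e1 := symmetrized_amplitude hij p q
        have e2 := hABe p q
        simp only [Matrix.add_apply, Matrix.smul_apply, smul_eq_mul, _root_.add_apply,
          _root_.smul_apply, ContinuousLinearMap.smulRight_apply, PiLp.add_apply,
          PiLp.smul_apply]
        linear_combination -c * t * e1 + t * e2
  · have := mul_nonneg ht0 hA.beta_nonneg
    have := mul_nonneg (sub_nonneg.2 ht1) hB.beta_nonneg
    linarith
  · have n1 := mul_nonneg ht0 hA.beta_nonneg
    have n2 := mul_nonneg (sub_nonneg.2 ht1) hB.beta_nonneg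
    rw [Set.inter_union_distrib_left, Set.inter_union_distrib_left]
    refine (measure_union_le _ _).trans ?_
    rw [add_comm (t * βA + _), ENNReal.ofReal_add (by positivity) (by positivity),
      ENNReal.ofReal_add n1 n2, ENNReal.ofReal_mul ht0, ENNReal.ofReal_mul (sub_nonneg.2 ht1)]
    refine add_le_add (volume_cube3_inter_transition hij t hδ.le) ((measure_union_le _ _).trans
      (hz.trans (add_le_add ?_ ?_)))
    · gcongr
      exact hA.volume_bad
    · gcongr
      exact hB.volume_bad
  · have := hA.S_nonneg
    have := hB.S_nonneg
    positivity
  · intro h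
    have sub : {x | (if Int.fract (phaseCLM i j (x + h)) < t then χ ((N : ℝ) • (x + h) + z)
        else χ' ((N : ℝ) • (x + h) + z)) ≠ if Int.fract (phaseCLM i j x) < t then
        χ ((N : ℝ) • x + z) else χ' ((N : ℝ) • x + z)} ⊆
        {x | Int.fract (phaseCLM i j x) ∈ transition t |phaseCLM i j h|} ∪
        ({x | (N : ℝ) • x + z ∈ {y | χ (y + (N : ℝ) • h) ≠ χ y}} ∪
        {x | (N : ℝ) • x + z ∈ {y | χ' (y + (N : ℝ) • h) ≠ χ' y}}) := by
      intro x hx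
      by_contra hn
      simp only [Set.mem_union, Set.mem_ofPred_eq, not_or, not_not] at hn
      obtain ⟨h1, h2, h3⟩ := hn
      have h4 : Int.fract (phaseCLM i j (x + h)) < t ↔ Int.fract (phaseCLM i j x) < t := by
        by_contra hne
        rw [map_add] at hne
        exact h1 (fract_mem_transition_of_lt_iff_ne hne)
      have e : (N : ℝ) • (x + h) + z = (N : ℝ) • x + z + (N : ℝ) • h := by
        rw [smul_add]
        abel
      apply hx
      rw [e, h2, h3]
      simp only [h4]
    have bound : ∀ {χ : V3 → Fin 3} {S : ℝ}, Measurable χ → ZPer χ →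
        (∀ h, volume (cube3 ∩ {x | χ (x + h) ≠ χ x}) ≤ ENNReal.ofReal (S * ‖h‖)) →
        volume (cube3 ∩ {x | (N : ℝ) • x + z ∈ {y | χ (y + (N : ℝ) • h) ≠ χ y}}) ≤
          ENNReal.ofReal (N * S * ‖h‖) := by
      intro χ S hm hp hS
      rw [volume_cube3_inter_dilate _ _ hN0]
      · refine (hS _).trans_eq ?_
        rw [norm_smul, Real.norm_natCast]
        ring_nf
      · exact (measurableSet_eq_fun (hm.comp (measurable_add_const _)) hm).compl
      · intro x n
        have : x + zlat n + (N : ℝ) • h = x + (N : ℝ) • h + zlat n := by abel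
        simp only [Set.mem_ofPred_eq, this, hp _ n]
    have hSA := hA.S_nonneg
    have hSB := hB.S_nonneg
    refine (measure_mono (Set.inter_subset_inter_right _ sub)).trans ?_
    rw [Set.inter_union_distrib_left, Set.inter_union_distrib_left]
    refine (measure_union_le _ _).trans ((add_le_add
      (volume_cube3_inter_transition hij t (abs_nonneg _)) ((measure_union_le _ _).trans
      (add_le_add (bound hA.measurable_phase hA.zper_phase hA.volume_shift)
      (bound hB.measurable_phase hB.zper_phase hB.volume_shift)))).trans ?_)
    rw [← ENNReal.ofReal_add (by positivity) (by positivity),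
      ← ENNReal.ofReal_add (by positivity) (by positivity)]
    apply ENNReal.ofReal_le_ofReal
    have := abs_phaseCLM_le i j h
    linarith

lemma isCompact_cube3 : IsCompact cube3 := by
  rw [cube3_eq_preimage]
  exact (PiLp.continuousLinearEquiv 2 ℝ (fun _ : Fin 3 => ℝ)).toHomeomorph.isCompact_preimage.2
    (isCompact_univ_pi fun _ => isCompact_Icc)

lemma setIntegral_cube3_add_right {F : V3 → ℝ} (hm : Measurable F) (hF : ZPer F) (z : V3) :
    ∫ x in cube3, F (x + z) = ∫ x in cube3, F x := by
  have hl : ∀ x, F x = F (torusLift (torusMk x)) := fun x => by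
    rw [torusLift_torusMk, hF]
  have hm' : Measurable fun y => F (torusLift y) := hm.comp measurable_torusLift
  have h1 := measurePreserving_torusMk
  have h2 := (measurePreserving_add_right (volume : Measure (UnitAddTorus (Fin 3)))
    (torusMk z)).comp h1
  have e1 : ∫ x in cube3, F x = ∫ y, F (torusLift y) := by
    rw [← h1.map_eq, integral_map h1.aemeasurable hm'.aestronglyMeasurable]
    exact integral_congr_ae (Filter.Eventually.of_forall hl)
  rw [e1, ← h2.map_eq, integral_map h2.aemeasurable hm'.aestronglyMeasurable]
  refine integral_congr_ae (Filter.Eventually.of_forall fun x => ?_)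
  have : torusMk (x + z) = torusMk x + torusMk z := by
    funext i
    simp [torusMk]
  simp only [Function.comp_apply]
  rw [hl, this]

lemma integral_mul_fderiv_le {f : V3 → ℝ} (hm : Measurable f) (hf : ∀ x, f x ∈ Set.Icc (0 : ℝ) 1)
    (hp : ZPer f) {S : ℝ} (hS0 : 0 ≤ S)
    (hS : ∀ h, volume (cube3 ∩ {x | f (x + h) ≠ f x}) ≤ ENNReal.ofReal (S * ‖h‖))
    {g : V3 → ℝ} (hg : ContDiff ℝ (⊤ : ℕ∞) g) (hgp : ZPer g) (hg1 : ∀ x, |g x| ≤ 1) {e : V3}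
    (he : ‖e‖ = 1) :
    Integrable (fun x => f x * fderiv ℝ g x e) (volume.restrict cube3) ∧
      ∫ x in cube3, f x * fderiv ℝ g x e ≤ S := by
  have hgc : Continuous g := hg.continuous
  have hg' : Continuous fun x => fderiv ℝ g x e :=
    (hg.continuous_fderiv (by simp)).clm_apply continuous_const
  have hgd : Differentiable ℝ g := hg.differentiable (by simp)
  have hfa : ∀ x, |f x| ≤ 1 := fun x => abs_le.2 ⟨by linarith [(hf x).1], (hf x).2⟩
  obtain ⟨B, hB⟩ := (isCompact_cube3.prod (isCompact_Icc (a := (-1 : ℝ)) (b := 1))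
    ).exists_bound_of_continuousOn (f := fun p : V3 × ℝ => fderiv ℝ g (p.1 + p.2 • e) e)
    (hg'.comp (continuous_fst.add (continuous_snd.smul continuous_const))).continuousOn
  have key := hasDerivAt_integral_of_dominated_loc_of_deriv_le
    (μ := (volume : Measure V3).restrict cube3) (x₀ := (0 : ℝ)) (s := Set.Icc (-1) 1)
    (F := fun τ x => f x * g (x + τ • e)) (F' := fun τ x => f x * fderiv ℝ g (x + τ • e) e)
    (bound := fun _ => B) (Icc_mem_nhds (by norm_num) (by norm_num))
    (Filter.Eventually.of_forall fun τ =>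
      (hm.mul (hgc.measurable.comp (measurable_add_const _))).aestronglyMeasurable)
    (by
      refine Integrable.of_bound (C := 1)
        (hm.mul (hgc.measurable.comp (measurable_add_const _))).aestronglyMeasurable
        (Filter.Eventually.of_forall fun x => ?_)
      rw [Real.norm_eq_abs, abs_mul]
      exact mul_le_one₀ (hfa x) (abs_nonneg _) (hg1 _))
    (hm.mul (hg'.measurable.comp (measurable_add_const _))).aestronglyMeasurable
    (by
      refine (ae_restrict_mem measurableSet_cube3).mono fun x hx τ hτ => ?_
      rw [norm_mul, Real.norm_eq_abs]
      exact (mul_le_mul (hfa x) (hB (x, τ) ⟨hx, hτ⟩) (norm_nonneg _) zero_le_one).trans_eq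
        (one_mul B))
    (integrable_const _)
    (Filter.Eventually.of_forall fun x τ _ => by
      have hl : HasDerivAt (fun τ : ℝ => x + τ • e) e τ := by
        simpa using ((hasDerivAt_id τ).smul_const e).const_add x
      exact ((hgd _).hasFDerivAt.comp_hasDerivAt τ hl).const_mul (f x))
  simp only [zero_smul, add_zero] at key
  refine ⟨key.1, ?_⟩
  have hshift : ∀ τ : ℝ, ∫ x in cube3, f x * g (x + τ • e) =
      ∫ x in cube3, f (x + -(τ • e)) * g x := by
    intro τ
    rw [← setIntegral_cube3_add_right (F := fun x => f (x + -(τ • e)) * g x) _ _ (τ • e)]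
    · simp
    · exact (hm.comp (measurable_add_const _)).mul hgc.measurable
    · intro x n
      have : x + zlat n + -(τ • e) = x + -(τ • e) + zlat n := by abel
      simp only [this, hp _ n, hgp x n]
  refine (le_abs_self _).trans (key.2.le_of_lip' hS0 (Filter.Eventually.of_forall fun τ => ?_))
  have hi : ∀ h : V3, Integrable (fun x => f (x + h) * g x) (volume.restrict cube3) := fun h => by
    refine Integrable.of_bound (C := 1)
      ((hm.comp (measurable_add_const _)).mul hgc.measurable).aestronglyMeasurable
      (Filter.Eventually.of_forall fun x => ?_)
    rw [Real.norm_eq_abs, abs_mul]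
    exact mul_le_one₀ (hfa _) (abs_nonneg _) (hg1 _)
  have hi0 := hi 0
  simp only [add_zero] at hi0
  have hDm : MeasurableSet {x | f (x + -(τ • e)) ≠ f x} :=
    (measurableSet_eq_fun (hm.comp (measurable_add_const _)) hm).compl
  simp only [zero_smul, add_zero, sub_zero]
  rw [hshift τ, ← integral_sub (hi _) hi0, Real.norm_eq_abs, Real.norm_eq_abs]
  calc |∫ x in cube3, (f (x + -(τ • e)) * g x - f x * g x)|
      ≤ ∫ x in cube3, {x | f (x + -(τ • e)) ≠ f x}.indicator (fun _ => (1 : ℝ)) x := by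
        rw [← Real.norm_eq_abs]
        refine norm_integral_le_of_norm_le ((integrable_const _).indicator hDm)
          (Filter.Eventually.of_forall fun x => ?_)
        by_cases hx : f (x + -(τ • e)) = f x
        · rw [Set.indicator_of_notMem (by simpa using hx), hx]
          simp
        · rw [Set.indicator_of_mem (by simpa using hx), ← sub_mul, Real.norm_eq_abs, abs_mul]
          refine mul_le_one₀ (abs_le.2 ⟨?_, ?_⟩) (abs_nonneg _) (hg1 x)
          · linarith [(hf x).2, (hf (x + -(τ • e))).1]
          · linarith [(hf x).1, (hf (x + -(τ • e))).2]
    _ = (volume (cube3 ∩ {x | f (x + -(τ • e)) ≠ f x})).toReal := by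
        rw [integral_indicator_const _ hDm, smul_eq_mul, mul_one, Measure.real,
          Measure.restrict_apply hDm, Set.inter_comm]
    _ ≤ S * |τ| := by
        refine ENNReal.toReal_le_of_le_ofReal (by positivity) ((hS _).trans_eq ?_)
        rw [norm_neg, norm_smul, he, mul_one, Real.norm_eq_abs]

/-- Control of translations yields a total-variation bound. -/
lemma isTVBound_of_shift {f : V3 → ℝ} (hm : Measurable f) (hf : ∀ x, f x ∈ Set.Icc (0 : ℝ) 1)
    (hp : ZPer f) {S : ℝ} (hS0 : 0 ≤ S)
    (hS : ∀ h, volume (cube3 ∩ {x | f (x + h) ≠ f x}) ≤ ENNReal.ofReal (S * ‖h‖)) :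
    IsTVBound f (3 * S) := by
  intro φ hφ hφp hφ1
  have hcomp : ∀ i : Fin 3, ∀ x, fderiv ℝ φ x (EuclideanSpace.single i 1) i =
      fderiv ℝ (fun y => φ y i) x (EuclideanSpace.single i 1) := by
    intro i x
    have h1 := (hφ.differentiable (by simp) x).hasFDerivAt
    have h2 := (EuclideanSpace.proj i : V3 →L[ℝ] ℝ).hasFDerivAt.comp x h1
    have h3 : HasFDerivAt (fun y => φ y i)
      ((EuclideanSpace.proj i : V3 →L[ℝ] ℝ).comp (fderiv ℝ φ x)) x := h2
    rw [h3.fderiv]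
    rfl
  have main := fun i : Fin 3 => integral_mul_fderiv_le hm hf hp hS0 hS (g := fun y => φ y i)
    ((EuclideanSpace.proj i : V3 →L[ℝ] ℝ).contDiff.comp hφ)
    (fun x n => by simp only [hφp x n])
    (fun x => (PiLp.norm_apply_le (φ x) i).trans (hφ1 x))
    (e := EuclideanSpace.single i 1) (by simp)
  simp only [hcomp, Finset.mul_sum]
  rw [integral_finsetSum _ fun i _ => (main i).1]
  calc _ ≤ ∑ _i : Fin 3, S := Finset.sum_le_sum fun i _ => (main i).2
    _ = 3 * S := by simp

/-- The scaling of the microstructures of branching order `n`: the bad set is of size `θ ^ n` and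
the perimeter is at most `K ^ (n * (n + m))`. -/
def Branches (W : Fin 3 → Matrix (Fin 3) (Fin 3) ℝ) (M θ : ℝ) (K : ℕ)
    (E : Matrix (Fin 3) (Fin 3) ℝ) : Prop :=
  Eᵀ = E ∧ ∃ c : ℝ, 0 ≤ c ∧ ∃ m : ℕ, ∀ n : ℕ, 1 ≤ n →
    Approx W M E (c * θ ^ n) (c * n) (c * (K : ℝ) ^ (n * (n + m)))

lemma inv_pow_le_pow {θ : ℝ} {K : ℕ} (hK : 4 ≤ K) (hθ : 1 ≤ θ * K) (n : ℕ) :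
    ((K : ℝ) ^ n)⁻¹ ≤ θ ^ n := by
  have hK0 : (0 : ℝ) < K := by exact_mod_cast (by omega : 0 < K)
  rw [← inv_pow]
  exact pow_le_pow_left₀ (by positivity) ((inv_le_iff_one_le_mul₀ hK0).2 hθ) n

lemma Branches.laminate {W : Fin 3 → Matrix (Fin 3) (Fin 3) ℝ} {M θ : ℝ} {K : ℕ}
    {A B : Matrix (Fin 3) (Fin 3) ℝ} (hA : Branches W M θ K A) (hB : Branches W M θ K B)
    (hM : 0 ≤ M) (hK : 4 ≤ K) (hθ0 : 0 < θ) (hθ : 1 ≤ θ * K) {i j : Fin 3} (hij : i ≠ j) {c : ℝ}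
    (hc : 4 * |c| ≤ M)
    (hAB : A - B = c • Matrix.diagonal (Pi.single i 1 - Pi.single j 1 : Fin 3 → ℝ)) {t : ℝ}
    (ht0 : 0 ≤ t) (ht1 : t ≤ 1) : Branches W M θ K (t • A + (1 - t) • B) := by
  obtain ⟨hAs, a, ha, m, hA⟩ := hA
  obtain ⟨hBs, b, hb, k, hB⟩ := hB
  have hK1 : (1 : ℝ) ≤ K := by exact_mod_cast (by omega : 1 ≤ K)
  refine ⟨by simp [hAs, hBs], a + b + 8 + 5 * M, by positivity, m + k + 1, fun n hn => ?_⟩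
  have hn1 : (1 : ℝ) ≤ n := by exact_mod_cast hn
  have hKn : 4 ≤ K ^ n := hK.trans (Nat.le_self_pow (by omega) K)
  have hKn0 : (0 : ℝ) < (K : ℝ) ^ n := by positivity
  refine ((hA n hn).laminate (hB n hn) hij hc hAB ht0 ht1 (δ := ((K : ℝ) ^ n)⁻¹) (by positivity)
    hKn (by rw [Nat.cast_pow, mul_inv_cancel₀ hKn0.ne'])).mono ?_ ?_ ?_
  · have h1 := inv_pow_le_pow hK hθ n
    have hp : 0 < θ ^ n := by positivity
    have h2 : t * (a * θ ^ n) ≤ a * θ ^ n := mul_le_of_le_one_left (by positivity) ht1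
    have h3 : (1 - t) * (b * θ ^ n) ≤ b * θ ^ n :=
      mul_le_of_le_one_left (by positivity) (by linarith)
    have h4 : 0 ≤ M * θ ^ n := by positivity
    linarith
  · have h1 : 5 * M ≤ 5 * M * n := le_mul_of_one_le_right (by positivity) hn1
    linarith
  · have h0 : (1 : ℝ) ≤ (K : ℝ) ^ (n * (n + (m + k + 1))) := one_le_pow₀ hK1
    have h1 : (K : ℝ) ^ n * (K : ℝ) ^ (n * (n + m)) ≤ (K : ℝ) ^ (n * (n + (m + k + 1))) := by
      rw [← pow_add]
      exact pow_le_pow_right₀ hK1 (by nlinarith [Nat.zero_le (n * k)])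
    have h2 : (K : ℝ) ^ n * (K : ℝ) ^ (n * (n + k)) ≤ (K : ℝ) ^ (n * (n + (m + k + 1))) := by
      rw [← pow_add]
      exact pow_le_pow_right₀ hK1 (by nlinarith [Nat.zero_le (n * m)])
    push_cast
    have h3 := mul_le_mul_of_nonneg_left h1 ha
    have h4 := mul_le_mul_of_nonneg_left h2 hb
    have h5 : 0 ≤ M * (K : ℝ) ^ (n * (n + (m + k + 1))) := by positivity
    linarith

lemma branches_well {W : Fin 3 → Matrix (Fin 3) (Fin 3) ℝ} {M θ : ℝ} {K : ℕ} (hM : 0 ≤ M)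
    (k : Fin 3) (hs : (W k)ᵀ = W k) : Branches W M θ K (W k) :=
  ⟨hs, 0, le_rfl, 0, fun n _ => by simpa using approx_well W hM k⟩

section Wells

variable {η₁ η₂ η₃ : ℝ}

lemma well3_transpose (j : Fin 3) : (well3 η₁ η₂ η₃ j)ᵀ = well3 η₁ η₂ η₃ j := by
  fin_cases j <;> simp [well3]

lemma Jmat3_transpose (j : Fin 3) : (Jmat3 η₁ η₂ η₃ j)ᵀ = Jmat3 η₁ η₂ η₃ j := by
  fin_cases j <;> simp [Jmat3]

lemma well3_sub_Jmat3_pred (j : Fin 3) : well3 η₁ η₂ η₃ j - Jmat3 η₁ η₂ η₃ (j + 2) =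
    (η₃ - η₁) • Matrix.diagonal (Pi.single j 1 - Pi.single (j + 2) 1 : Fin 3 → ℝ) := by
  ext p q
  fin_cases j <;> fin_cases p <;> fin_cases q <;> simp [well3, Jmat3, Matrix.diagonal] <;> ring

lemma well3_sub_Jmat3 (j : Fin 3) : well3 η₁ η₂ η₃ j - Jmat3 η₁ η₂ η₃ j =
    (η₁ - η₂) • Matrix.diagonal (Pi.single j 1 - Pi.single (j + 2) 1 : Fin 3 → ℝ) := by
  ext p q
  fin_cases j <;> fin_cases p <;> fin_cases q <;> simp [well3, Jmat3, Matrix.diagonal]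
  all_goals ring

lemma Jmat3_sub_Jmat3 (i j : Fin 3) : Jmat3 η₁ η₂ η₃ i - Jmat3 η₁ η₂ η₃ j =
    (η₂ + η₃ - 2 * η₁) • Matrix.diagonal (Pi.single i 1 - Pi.single j 1 : Fin 3 → ℝ) := by
  ext p q
  fin_cases i <;> fin_cases j <;> fin_cases p <;> fin_cases q <;>
    simp [Jmat3, Matrix.diagonal] <;> ring

lemma Jmat3_eq {θ : ℝ} (hθ : θ * (η₃ - η₁) = η₁ - η₂) (j : Fin 3) :
    (1 - θ) • well3 η₁ η₂ η₃ j + (1 - (1 - θ)) • Jmat3 η₁ η₂ η₃ (j + 2) = Jmat3 η₁ η₂ η₃ j := by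
  have h1 := well3_sub_Jmat3_pred (η₁ := η₁) (η₂ := η₂) (η₃ := η₃) j
  have h2 := well3_sub_Jmat3 (η₁ := η₁) (η₂ := η₂) (η₃ := η₃) j
  rw [← hθ, mul_smul, ← h1] at h2
  rw [eq_sub_of_add_eq' (sub_eq_iff_eq_add.1 h2).symm]
  module

lemma approx_Jmat3 {θ M : ℝ} (hM : 4 * |η₃ - η₁| ≤ M) (hθ : θ * (η₃ - η₁) = η₁ - η₂)
    (hθ0 : 0 < θ) (hθ1 : θ < 1) {δ : ℝ} (hδ : 0 < δ) {N : ℕ} (hN : 4 ≤ N) (hNδ : 1 ≤ N * δ)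
    (m : ℕ) : ∀ j, Approx (well3 η₁ η₂ η₃) M (Jmat3 η₁ η₂ η₃ j) (θ ^ m + 4 * δ / (1 - θ))
      (5 * M * m) (8 * ((N : ℝ) ^ m - 1)) := by
  have hM0 : 0 ≤ M := (by positivity : 0 ≤ 4 * |η₃ - η₁|).trans hM
  have hθ' : 0 < 1 - θ := by linarith
  induction m with
  | zero =>
    intro j
    refine (approx_trivial _ hM0 _).mono ?_ ?_ ?_ <;> simp
    positivity
  | succ m ih =>
    intro j
    have hj : j ≠ j + 2 := by fin_cases j <;> decide
    have h := (approx_well (well3 η₁ η₂ η₃) hM0 j).laminate (ih (j + 2)) hj hM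
      (well3_sub_Jmat3_pred j) hθ'.le (by linarith) hδ hN hNδ
    rw [Jmat3_eq hθ] at h
    refine h.mono (le_of_eq ?_) (le_of_eq ?_) ?_
    · field_simp
      ring
    · push_cast
      ring
    · have : (4 : ℝ) ≤ N := by exact_mod_cast hN
      rw [pow_succ]
      linarith

lemma branches_Jmat3 {θ M : ℝ} {K : ℕ} (hM : 4 * |η₃ - η₁| ≤ M)
    (hθ : θ * (η₃ - η₁) = η₁ - η₂) (hθ0 : 0 < θ) (hθ1 : θ < 1) (hK : 4 ≤ K) (hθK : 1 ≤ θ * K)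
    (j : Fin 3) : Branches (well3 η₁ η₂ η₃) M θ K (Jmat3 η₁ η₂ η₃ j) := by
  have hM0 : 0 ≤ M := (by positivity : 0 ≤ 4 * |η₃ - η₁|).trans hM
  have hθ' : 0 < 1 - θ := by linarith
  have hq : 0 < 4 / (1 - θ) := by positivity
  have hK0 : (0 : ℝ) < K := by exact_mod_cast (by omega : 0 < K)
  refine ⟨Jmat3_transpose j, 8 + 5 * M + 4 / (1 - θ), by positivity, 0, fun n hn => ?_⟩
  have hKn : 4 ≤ K ^ n := hK.trans (Nat.le_self_pow (by omega) K)
  have hKn0 : (0 : ℝ) < (K : ℝ) ^ n := by positivity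
  refine (approx_Jmat3 hM hθ hθ0 hθ1 (δ := ((K : ℝ) ^ n)⁻¹) (by positivity) hKn
    (by rw [Nat.cast_pow, mul_inv_cancel₀ hKn0.ne']) n j).mono ?_ ?_ ?_
  · have h1 := mul_le_mul_of_nonneg_left (inv_pow_le_pow hK hθK n) hq.le
    have hp : 0 < θ ^ n := by positivity
    have h4 : 0 ≤ M * θ ^ n := by positivity
    have h5 : 4 * ((K : ℝ) ^ n)⁻¹ / (1 - θ) = 4 / (1 - θ) * ((K : ℝ) ^ n)⁻¹ := by ring
    rw [h5]
    linarith
  · have : 0 ≤ (8 + 4 / (1 - θ)) * n := by positivity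
    linarith
  · rw [Nat.cast_pow, ← pow_mul, add_zero]
    have : 0 ≤ (5 * M + 4 / (1 - θ)) * (K : ℝ) ^ (n * n) := by positivity
    linarith

lemma branches_Eset3 {θ M : ℝ} {K : ℕ} (h1 : η₂ < η₁) (h2 : η₁ < η₃) (h3 : 2 * η₁ < η₂ + η₃)
    (hM : M = 4 * (η₃ - η₁)) (hθ : θ * (η₃ - η₁) = η₁ - η₂) (hθ0 : 0 < θ) (hθ1 : θ < 1)
    (hK : 4 ≤ K) (hθK : 1 ≤ θ * K) {E : Matrix (Fin 3) (Fin 3) ℝ} (hE : E ∈ Eset3 η₁ η₂ η₃) :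
    Branches (well3 η₁ η₂ η₃) M θ K E := by
  have hM0 : 0 ≤ M := by linarith
  have hJ := branches_Jmat3 (η₁ := η₁) (η₂ := η₂) (η₃ := η₃) (M := M)
    (by rw [abs_of_pos (by linarith), hM]) hθ hθ0 hθ1 hK hθK
  rcases hE with hE | hE
  · rw [convexHull_insert (by simp), convexHull_pair, mem_convexJoin] at hE
    obtain ⟨P, hP, Q, hQ, hE⟩ := hE
    obtain rfl : P = Jmat3 η₁ η₂ η₃ 0 := hP
    obtain ⟨a, b, ha, hb, hab, rfl⟩ := hQ
    obtain ⟨s, r, hs, hr, hsr, rfl⟩ := hE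
    obtain rfl : b = 1 - a := by linarith
    obtain rfl : s = 1 - r := by linarith
    have key : (1 - r) • Jmat3 η₁ η₂ η₃ 0 +
        r • (a • Jmat3 η₁ η₂ η₃ 1 + (1 - a) • Jmat3 η₁ η₂ η₃ 2) =
        a • (r • Jmat3 η₁ η₂ η₃ 1 + (1 - r) • Jmat3 η₁ η₂ η₃ 0) +
          (1 - a) • (r • Jmat3 η₁ η₂ η₃ 2 + (1 - r) • Jmat3 η₁ η₂ η₃ 0) := by
      module
    have hc : 4 * |η₂ + η₃ - 2 * η₁| ≤ M := by
      rw [abs_of_pos (by linarith)]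
      linarith
    rw [key]
    refine ((hJ 1).laminate (hJ 0) hM0 hK hθ0 hθK (by decide) hc (Jmat3_sub_Jmat3 1 0) hr
      (by linarith)).laminate ((hJ 2).laminate (hJ 0) hM0 hK hθ0 hθK (by decide) hc
      (Jmat3_sub_Jmat3 2 0) hr (by linarith)) hM0 hK hθ0 hθK (i := 1) (j := 2) (by decide)
      (c := r * (η₂ + η₃ - 2 * η₁)) ?_ ?_ ha (by linarith)
    · rw [abs_mul, abs_of_nonneg hr]
      nlinarith [abs_nonneg (η₂ + η₃ - 2 * η₁)]
    · rw [mul_smul, ← Jmat3_sub_Jmat3]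
      module
  · obtain ⟨j, hj⟩ := Set.mem_iUnion.1 hE
    obtain ⟨a, b, ha, hb, hab, rfl⟩ := hj
    obtain rfl : a = 1 - b := by linarith
    have hj : j ≠ j + 2 := by fin_cases j <;> decide
    rw [add_comm]
    refine (branches_well hM0 j (well3_transpose j)).laminate (hJ j) hM0 hK hθ0 hθK hj ?_
      (well3_sub_Jmat3 j) hb (by linarith)
    rw [abs_of_pos (by linarith)]
    linarith

end Wells

set_option maxHeartbeats 1000000 in
lemma exists_order_le {θ c d K : ℝ} (hθ0 : 0 < θ) (hθ1 : θ < 1) (hK : 1 < K) (hc : 0 ≤ c)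
    (hd : 0 ≤ d) (m : ℕ) :
    ∃ ε₀ C₂ C : ℝ, 0 < ε₀ ∧ 0 < C₂ ∧ 0 < C ∧ ∀ ε : ℝ, 0 < ε → ε < ε₀ → ∃ n : ℕ, 1 ≤ n ∧
      9 * (d + c * n) ^ 2 * (c * θ ^ n) + ε * (9 * (c * K ^ (n * (n + m)))) ≤
        C₂ * Real.exp (-(C * |Real.log ε| ^ ((1 : ℝ) / 2))) := by
  set a := Real.log K with ha
  set b := -Real.log θ with hb
  have ha0 : 0 < a := Real.log_pos hK
  have hb0 : 0 < b := neg_pos.2 (Real.log_neg hθ0 hθ1)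
  set r := Real.sqrt (1 / (2 * a * (1 + m))) with hr
  have hr0 : 0 < r := Real.sqrt_pos.2 (by positivity)
  have hr2 : r ^ 2 * (2 * a * (1 + m)) = 1 := by
    rw [hr, Real.sq_sqrt (by positivity)]
    field_simp
  set D := 9 * (d + c) ^ 2 * c * (16 / b ^ 2) * Real.exp (b / 2) with hD
  have hD0 : 0 ≤ D := by positivity
  set C := min (1 / 2) (b * r / 2) with hC
  refine ⟨Real.exp (-(1 + 1 / r) ^ 2), D + 9 * c + 1, C, Real.exp_pos _, by positivity,
    lt_min (by norm_num) (by positivity), fun ε hε0 hε => ?_⟩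
  have hlog : (1 + 1 / r) ^ 2 < -Real.log ε := by
    have := (Real.log_lt_iff_lt_exp hε0).2 hε
    linarith
  rw [abs_of_neg (by nlinarith [sq_nonneg (1 + 1 / r)]), ← Real.sqrt_eq_rpow]
  set q := Real.sqrt (-Real.log ε) with hq
  have hq2 : q ^ 2 = -Real.log ε := Real.sq_sqrt (by nlinarith [sq_nonneg (1 + 1 / r)])
  have hε' : ε = Real.exp (-q ^ 2) := by
    rw [hq2, neg_neg, Real.exp_log hε0]
  have hr' : 0 < 1 / r := by positivity
  have hq1 : 1 + 1 / r ≤ q := Real.le_sqrt_of_sq_le hlog.le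
  have hrq : 1 ≤ r * q := by
    have := mul_le_mul_of_nonneg_left hq1 hr0.le
    rw [mul_add, mul_one_div_cancel hr0.ne'] at this
    linarith
  set n := ⌊r * q⌋₊ with hn
  have hn1 : 1 ≤ n := (Nat.one_le_floor_iff _).2 hrq
  have hn1' : (1 : ℝ) ≤ n := by exact_mod_cast hn1
  have hnle : (n : ℝ) ≤ r * q := Nat.floor_le (by linarith)
  have hnlt : r * q < n + 1 := Nat.lt_floor_add_one _
  clear_value a b r D C q n
  refine ⟨n, hn1, ?_⟩
  have hexp1 : Real.exp (-(b * r / 2 * q)) ≤ Real.exp (-(C * q)) := by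
    refine Real.exp_le_exp.2 (neg_le_neg
      (mul_le_mul_of_nonneg_right (hC.trans_le (min_le_right _ _)) ?_))
    linarith
  have hexp2 : Real.exp (-(1 / 2 * q)) ≤ Real.exp (-(C * q)) := by
    refine Real.exp_le_exp.2 (neg_le_neg
      (mul_le_mul_of_nonneg_right (hC.trans_le (min_le_left _ _)) ?_))
    linarith
  have hθn : θ ^ n = Real.exp (-(b * n)) := by
    rw [hb, neg_mul, neg_neg, mul_comm, Real.exp_nat_mul, Real.exp_log hθ0]
  have helastic : 9 * (d + c * n) ^ 2 * (c * θ ^ n) ≤ D * Real.exp (-(C * q)) := by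
    have e1 : d + c * n ≤ (d + c) * n := by nlinarith
    have e2 : (d + c * n) ^ 2 ≤ (d + c) ^ 2 * n ^ 2 := by
      rw [← mul_pow]
      exact pow_le_pow_left₀ (by positivity) e1 2
    have e3 : (n : ℝ) ^ 2 ≤ 16 / b ^ 2 * Real.exp (b * n / 2) := by
      have h1 : b * n / 4 ≤ Real.exp (b * n / 4) := by linarith [Real.add_one_le_exp (b * n / 4)]
      have h2 : (b * n / 4) ^ 2 ≤ Real.exp (b * n / 4) ^ 2 := pow_le_pow_left₀ (by positivity) h1 2
      rw [← Real.exp_nat_mul] at h2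
      have h3 : ((2 : ℕ) : ℝ) * (b * n / 4) = b * n / 2 := by push_cast; ring
      rw [h3] at h2
      calc (n : ℝ) ^ 2 = 16 / b ^ 2 * (b * n / 4) ^ 2 := by field_simp; ring
        _ ≤ _ := mul_le_mul_of_nonneg_left h2 (by positivity)
    have e4 : Real.exp (b * n / 2) * θ ^ n ≤ Real.exp (b / 2) * Real.exp (-(C * q)) := by
      rw [hθn, ← Real.exp_add]
      refine le_trans ?_ (mul_le_mul_of_nonneg_left hexp1 (Real.exp_pos _).le)
      rw [← Real.exp_add]
      refine Real.exp_le_exp.2 ?_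
      nlinarith [mul_lt_mul_of_pos_left hnlt hb0]
    have e5 : 0 < θ ^ n := by positivity
    calc 9 * (d + c * n) ^ 2 * (c * θ ^ n)
        ≤ 9 * ((d + c) ^ 2 * (16 / b ^ 2 * Real.exp (b * n / 2))) * (c * θ ^ n) := by
          gcongr
          exact e2.trans (mul_le_mul_of_nonneg_left e3 (by positivity))
      _ = 9 * (d + c) ^ 2 * c * (16 / b ^ 2) * (Real.exp (b * n / 2) * θ ^ n) := by ring
      _ ≤ 9 * (d + c) ^ 2 * c * (16 / b ^ 2) * (Real.exp (b / 2) * Real.exp (-(C * q))) :=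
          mul_le_mul_of_nonneg_left e4 (by positivity)
      _ = D * Real.exp (-(C * q)) := by rw [hD]; ring
  have hsurface : ε * K ^ (n * (n + m)) ≤ Real.exp (-(C * q)) := by
    have f1 : K ^ (n * (n + m)) = Real.exp (a * (n * (n + m))) := by
      have : a * (n * (n + m)) = ((n * (n + m) : ℕ) : ℝ) * a := by push_cast; ring
      rw [this, Real.exp_nat_mul, ha, Real.exp_log (zero_lt_one.trans hK)]
    have f2 : a * ((n : ℝ) * (n + m)) ≤ q ^ 2 / 2 := by
      have g1 : (n : ℝ) * (n + m) ≤ n ^ 2 * (1 + m) := by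
        have : (m : ℝ) * n ≤ m * n ^ 2 :=
            mul_le_mul_of_nonneg_left (le_self_pow₀ hn1' two_ne_zero) (Nat.cast_nonneg m)
        linarith
      have g2 : (n : ℝ) ^ 2 ≤ (r * q) ^ 2 := pow_le_pow_left₀ (by positivity) hnle 2
      calc a * ((n : ℝ) * (n + m)) ≤ a * ((r * q) ^ 2 * (1 + m)) := by
            exact mul_le_mul_of_nonneg_left
              (g1.trans (mul_le_mul_of_nonneg_right g2 (by positivity))) ha0.le
        _ = r ^ 2 * (2 * a * (1 + m)) * q ^ 2 / 2 := by ring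
        _ = q ^ 2 / 2 := by rw [hr2, one_mul]
    refine le_trans ?_ hexp2
    rw [f1, hε', ← Real.exp_add]
    exact Real.exp_le_exp.2 (by linarith [sq_nonneg (q - 1)])
  have := mul_le_mul_of_nonneg_left hsurface (by positivity : 0 ≤ 9 * c)
  have := Real.exp_pos (-(C * q))
  linarith

lemma Realises.exists_energy_le {η₁ η₂ η₃ : ℝ} {M : ℝ} {E : Matrix (Fin 3) (Fin 3) ℝ}
    {β L S : ℝ} {v : V3 → V3} {χ : V3 → Fin 3} {bad : Set V3}
    (h : Realises (well3 η₁ η₂ η₃) M E β L S v χ bad) (hE : Eᵀ = E) (hL : 0 ≤ L) {d : ℝ}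
    (hd : ∀ k p q, ‖Matrix.toEuclideanCLM (n := Fin 3) (𝕜 := ℝ) E‖ + |well3 η₁ η₂ η₃ k p q| ≤ d) :
    (∫ x in cube3, ∑ i : Fin 3, ∑ j : Fin 3,
      (symGrad3 (fun x => vec3 ((E + 0).mulVec fun i => x i) + v x) x i j -
        well3 η₁ η₂ η₃ (χ x) i j) ^ 2) ≤ 9 * (d + L) ^ 2 * β := by
  set T : V3 →L[ℝ] V3 := Matrix.toEuclideanCLM (n := Fin 3) (𝕜 := ℝ) E with hT
  set u : V3 → V3 := fun x => vec3 ((E + 0).mulVec fun i => x i) + v x with hu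
  have huT : u = fun x => T x + v x := by
    funext x
    simp only [hu, add_zero]
    rfl
  have hTs : ∀ p q, T (EuclideanSpace.single q 1) p = E p q := by
    intro p q
    have : T (EuclideanSpace.single q 1) p = (E.mulVec (Pi.single q 1)) p := rfl
    rw [this]
    simp
  have hd0 : 0 ≤ d := (by positivity : 0 ≤ ‖T‖ + |well3 η₁ η₂ η₃ 0 0 0|).trans (hd 0 0 0)
  have hbound : ∀ x i j, |symGrad3 u x i j| ≤ ‖T‖ + L := by
    intro x i j
    have h1 : ‖fderiv ℝ u x‖ ≤ ‖T‖ + L := by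
      have : LipschitzWith (Real.toNNReal (‖T‖ + L)) u := by
        refine LipschitzWith.of_dist_le_mul fun x y => ?_
        rw [Real.coe_toNNReal _ (by positivity), dist_eq_norm, dist_eq_norm, huT]
        have e : T x + v x - (T y + v y) = T (x - y) + (v x - v y) := by
          rw [map_sub]
          abel
        rw [e, add_mul]
        exact (norm_add_le _ _).trans (add_le_add (T.le_opNorm _) (h.lipschitz x y))
      have h2 := norm_fderiv_le_of_lipschitz ℝ (x₀ := x) this
      rwa [Real.coe_toNNReal _ (by positivity)] at h2
    have h2 : ∀ p q : Fin 3, |fderiv ℝ u x (EuclideanSpace.single p 1) q| ≤ ‖T‖ + L := by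
      intro p q
      rw [← Real.norm_eq_abs]
      refine ((PiLp.norm_apply_le _ q).trans ((fderiv ℝ u x).le_opNorm _)).trans ?_
      simpa using h1
    rw [symGrad3, abs_div, abs_two, div_le_iff₀ two_pos]
    refine (abs_add_le _ _).trans ?_
    linarith [h2 j i, h2 i j]
  have hgood : ∀ x ∉ bad, ∀ i j, symGrad3 u x i j = well3 η₁ η₂ η₃ (χ x) i j := by
    intro x hx i j
    obtain ⟨D, hD, hW⟩ := h.strain x hx
    have h1 : fderiv ℝ u x = T + D := by
      rw [huT]
      exact (T.hasFDerivAt.add hD).fderiv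
    have h2 : E j i = E i j := congrFun (congrFun hE i) j
    rw [← hW i j, symGrad3, h1]
    simp only [_root_.add_apply, PiLp.add_apply, hTs, h2]
    ring
  have hpoint : ∀ x, ∑ i : Fin 3, ∑ j : Fin 3, (symGrad3 u x i j -
      well3 η₁ η₂ η₃ (χ x) i j) ^ 2 ≤ bad.indicator (fun _ => 9 * (d + L) ^ 2) x := by
    intro x
    by_cases hx : x ∈ bad
    · rw [Set.indicator_of_mem hx]
      calc ∑ i : Fin 3, ∑ j : Fin 3, (symGrad3 u x i j - well3 η₁ η₂ η₃ (χ x) i j) ^ 2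
          ≤ ∑ _i : Fin 3, ∑ _j : Fin 3, (d + L) ^ 2 := by
            refine Finset.sum_le_sum fun i _ => Finset.sum_le_sum fun j _ => ?_
            refine sq_le_sq' ?_ ?_ <;>
              linarith [abs_le.1 (hbound x i j), hd (χ x) i j,
                neg_abs_le (well3 η₁ η₂ η₃ (χ x) i j), le_abs_self (well3 η₁ η₂ η₃ (χ x) i j),
                (abs_le.1 (hbound x i j)).1, (abs_le.1 (hbound x i j)).2]
        _ = 9 * (d + L) ^ 2 := by
            simp
            ring
    · rw [Set.indicator_of_notMem hx]
      simp [hgood x hx]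
  calc _ ≤ ∫ x in cube3, bad.indicator (fun _ => 9 * (d + L) ^ 2) x := by
        refine integral_mono_of_nonneg (Filter.Eventually.of_forall fun x => ?_)
          ((integrable_const _).indicator h.measurableSet_bad)
          (Filter.Eventually.of_forall hpoint)
        exact Finset.sum_nonneg fun i _ => Finset.sum_nonneg fun j _ => sq_nonneg _
    _ = (volume (cube3 ∩ bad)).toReal * (9 * (d + L) ^ 2) := by
        rw [integral_indicator_const _ h.measurableSet_bad, smul_eq_mul, Measure.real,
          Measure.restrict_apply h.measurableSet_bad, Set.inter_comm]
    _ ≤ β * (9 * (d + L) ^ 2) := by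
        gcongr
        exact ENNReal.toReal_le_of_le_ofReal h.beta_nonneg h.volume_bad
    _ = _ := mul_comm _ _

lemma Realises.isTVBound {η₁ η₂ η₃ : ℝ} {W : Fin 3 → Matrix (Fin 3) (Fin 3) ℝ} {M : ℝ}
    {E : Matrix (Fin 3) (Fin 3) ℝ} {β L S : ℝ} {v : V3 → V3} {χ : V3 → Fin 3} {bad : Set V3}
    (h : Realises W M E β L S v χ bad) (j : Fin 3) :
    IsTVBound (indic3 η₁ η₂ η₃ (fun x => well3 η₁ η₂ η₃ (χ x)) j) (3 * S) := by
  have hloc : ∀ x y, χ x = χ y → indic3 η₁ η₂ η₃ (fun x => well3 η₁ η₂ η₃ (χ x)) j x =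
      indic3 η₁ η₂ η₃ (fun x => well3 η₁ η₂ η₃ (χ x)) j y := by
    intro x y hxy
    simp only [indic3, Set.indicator, Set.mem_ofPred_eq, hxy]
  refine isTVBound_of_shift (measurable_const.indicator
    (h.measurable_phase (Set.toFinite {k | well3 η₁ η₂ η₃ k = well3 η₁ η₂ η₃ j}).measurableSet))
    (fun x => ?_) (fun x n => hloc _ _ (h.zper_phase x n)) h.S_nonneg fun k =>
      (measure_mono ?_).trans (h.volume_shift k)
  · simp only [Set.indicator]
    split_ifs <;> simp
  · exact Set.inter_subset_inter_right _ fun x hx hxk => hx (hloc _ _ hxk)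

/-- upper scaling bound for the energy of the T₃-structure on the torus. -/
theorem stmt16 (η₁ η₂ η₃ : ℝ) (h1 : η₂ < η₁) (h2 : η₁ < η₃) (h3 : 2 * η₁ < η₂ + η₃)
    (ebar : Matrix (Fin 3) (Fin 3) ℝ) (hebar : ebar ∈ Eset3 η₁ η₂ η₃) :
    ∃ ε₀ C₂ C : ℝ, 0 < ε₀ ∧ 0 < C₂ ∧ 0 < C ∧
    ∀ ε : ℝ, 0 < ε → ε < ε₀ →
    ∃ u : V3 → V3, Admissible ebar u ∧
    ∃ χ : V3 → Matrix (Fin 3) (Fin 3) ℝ,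
      (∀ i j : Fin 3, Measurable fun x => χ x i j) ∧ ZPer χ ∧ (∀ x, χ x ∈ K3 η₁ η₂ η₃) ∧
    ∃ S₁ S₂ S₃ : ℝ,
      IsTVBound (indic3 η₁ η₂ η₃ χ 0) S₁ ∧
      IsTVBound (indic3 η₁ η₂ η₃ χ 1) S₂ ∧
      IsTVBound (indic3 η₁ η₂ η₃ χ 2) S₃ ∧
      (∫ x in cube3, ∑ i : Fin 3, ∑ j : Fin 3, (symGrad3 u x i j - χ x i j) ^ 2) +
          ε * (S₁ + S₂ + S₃) ≤
        C₂ * Real.exp (-(C * |Real.log ε| ^ ((1 : ℝ) / 2))) := by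
  set θ := (η₁ - η₂) / (η₃ - η₁) with hθ
  have h13 : 0 < η₃ - η₁ := by linarith
  have hθ0 : 0 < θ := div_pos (by linarith) h13
  have hθ1 : θ < 1 := (div_lt_one h13).2 (by linarith)
  obtain ⟨k, hk⟩ := exists_nat_ge (1 / θ)
  have hθK : 1 ≤ θ * ((k + 4 : ℕ) : ℝ) := by
    rw [div_le_iff₀ hθ0] at hk
    push_cast
    linarith
  obtain ⟨hsym, c, hc, m, happrox⟩ := branches_Eset3 h1 h2 h3 rfl (div_mul_cancel₀ _ h13.ne')
    hθ0 hθ1 (by omega) hθK hebar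
  set d := ‖Matrix.toEuclideanCLM (n := Fin 3) (𝕜 := ℝ) ebar‖ +
    ∑ k, ∑ p, ∑ q, |well3 η₁ η₂ η₃ k p q| with hd
  have hd0 : 0 ≤ d := by positivity
  have hdle : ∀ k p q, ‖Matrix.toEuclideanCLM (n := Fin 3) (𝕜 := ℝ) ebar‖ +
      |well3 η₁ η₂ η₃ k p q| ≤ d := fun k p q => by
    refine (add_le_add_iff_left _).2 ?_
    refine le_trans ?_ (Finset.single_le_sum (f := fun k => ∑ p, ∑ q, |well3 η₁ η₂ η₃ k p q|)
      (fun _ _ => by positivity) (Finset.mem_univ k))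
    refine le_trans ?_ (Finset.single_le_sum (f := fun p => ∑ q, |well3 η₁ η₂ η₃ k p q|)
      (fun _ _ => by positivity) (Finset.mem_univ p))
    exact Finset.single_le_sum (f := fun q => |well3 η₁ η₂ η₃ k p q|)
      (fun _ _ => by positivity) (Finset.mem_univ q)
  have hK1 : (1 : ℝ) < (k + 4 : ℕ) := by exact_mod_cast (by omega : 1 < k + 4)
  obtain ⟨ε₀, C₂, C, hε₀, hC₂, hC, hmain⟩ := exists_order_le hθ0 hθ1 hK1 hc hd0 m
  refine ⟨ε₀, C₂, C, hε₀, hC₂, hC, fun ε hε0 hε => ?_⟩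
  obtain ⟨n, hn, hle⟩ := hmain ε hε0 hε
  obtain ⟨v, χ, bad, h⟩ := happrox n hn
  have hL : 0 ≤ c * n := by positivity
  refine ⟨fun x => vec3 ((ebar + 0).mulVec fun i => x i) + v x,
    ⟨0, by simp, v, Real.toNNReal (c * n), ?_, h.zper, rfl⟩, fun x => well3 η₁ η₂ η₃ (χ x),
    fun i j => (measurable_of_finite fun k => well3 η₁ η₂ η₃ k i j).comp h.measurable_phase,
    fun x z => by simp only [h.zper_phase x z], fun x => ?_, _, _, _, h.isTVBound 0,
    h.isTVBound 1, h.isTVBound 2, ?_⟩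
  · refine LipschitzWith.of_dist_le_mul fun x y => ?_
    rw [Real.coe_toNNReal _ hL, dist_eq_norm, dist_eq_norm]
    exact h.lipschitz x y
  · have hK3 : ∀ j, well3 η₁ η₂ η₃ j ∈ K3 η₁ η₂ η₃ := fun j => by
      fin_cases j <;> simp [K3]
    exact hK3 (χ x)
  · refine le_trans ?_ hle
    have := h.exists_energy_le hsym hL hdle
    linarith
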